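/- (Theorem 6.2: Amitsur #-superidentities characterize hook containment.) Let F be a field of characteristic zero and A a #-superalgebra over F which is a PI-algebra, and fix integers d₁,l₁,d₂,l₂,d₃,l₃,d₄,l₄ ≥ 0. Then A satisfies the Amitsur #-superidentity of rank ⟨d,l⟩ = (d₁,l₁;d₂,l₂;d₃,l₃;d₄,l₄) if and only if: for every quadruple ⟨n⟩ = (n₁,n₂,n₃,n₄), every multipartition ⟨λ⟩ ⊢ ⟨n⟩ with λ(i) ∉ H(dᵢ,lᵢ) for at least one i ∈ {1,2,3,4}, every Young multitableau T⟨λ⟩ of shape ⟨λ⟩, and every f ∈ P⟨n⟩, one has e_{T⟨λ⟩}·f ∈ Id₂#(A) (equivalently, the multiplicity m⟨λ⟩ in the ⟨n⟩-th #-cocharacter of A vanishes whenever ⟨λ⟩ lies outside the quadruple hook). -/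

import Mathlib

open scoped Classical

noncomputable section

namespace SSA

/-- Ordered product of a list of elements of a (possibly non-unital) multiplicative
structure; `0` for the empty list. -/
def listProd {A : Type*} [Mul A] [Zero A] : List A → A
  | [] => 0
  | [a] => a
  | a :: b :: l => a * listProd (b :: l)

/-- The ordered product `a 0 * a 1 * ⋯ * a (n-1)`. -/
def finProd {A : Type*} [Mul A] [Zero A] {n : ℕ} (a : Fin n → A) : A :=
  listProd (List.ofFn a)

/-- `A` is a PI-algebra over `F`: it satisfies a nontrivial multilinear polynomial identity. -/
def IsPI (F A : Type*) [Field F] [NonUnitalRing A] [Module F A] : Prop :=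
  ∃ n : ℕ, 1 ≤ n ∧ ∃ c : Equiv.Perm (Fin n) → F, c ≠ 0 ∧
    ∀ a : Fin n → A, ∑ σ : Equiv.Perm (Fin n), c σ • finProd (fun i => a (σ i)) = 0

variable (F : Type*) [Field F]

/-- A `#`-superalgebra: an associative (not necessarily unital) `F`-algebra `A` with a
`ℤ₂`-grading `A = A₀ ⊕ A₁` and a linear map `#` which is a graded involution or a
superinvolution. -/
structure SuperAlg (A : Type*) [NonUnitalRing A] [Module F A]
    [SMulCommClass F A A] [IsScalarTower F A A] : Type _ where
  A0 : Submodule F A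
  A1 : Submodule F A
  sup_eq_top : A0 ⊔ A1 = ⊤
  inf_eq_bot : A0 ⊓ A1 = ⊥
  mul_mem00 : ∀ a ∈ A0, ∀ b ∈ A0, a * b ∈ A0
  mul_mem01 : ∀ a ∈ A0, ∀ b ∈ A1, a * b ∈ A1
  mul_mem10 : ∀ a ∈ A1, ∀ b ∈ A0, a * b ∈ A1
  mul_mem11 : ∀ a ∈ A1, ∀ b ∈ A1, a * b ∈ A0
  sharp : A →ₗ[F] A
  sharp_sharp : ∀ a, sharp (sharp a) = a
  sharp_mem0 : ∀ a ∈ A0, sharp a ∈ A0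
  sharp_mem1 : ∀ a ∈ A1, sharp a ∈ A1
  gradedInvolution_or_superInvolution :
    (∀ a b : A, sharp (a * b) = sharp b * sharp a) ∨
    ((∀ a ∈ A0, ∀ b ∈ A0, sharp (a * b) = sharp b * sharp a) ∧
     (∀ a ∈ A0, ∀ b ∈ A1, sharp (a * b) = sharp b * sharp a) ∧
     (∀ a ∈ A1, ∀ b ∈ A0, sharp (a * b) = sharp b * sharp a) ∧
     (∀ a ∈ A1, ∀ b ∈ A1, sharp (a * b) = -(sharp b * sharp a)))

variable {F}

/-- The four components `A₀⁺, A₀⁻, A₁⁺, A₁⁻` of a `#`-superalgebra (types `0,1,2,3`). -/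
def SuperAlg.comp {A : Type*} [NonUnitalRing A] [Module F A]
    [SMulCommClass F A A] [IsScalarTower F A A] (S : SuperAlg F A) (i : Fin 4) :
    Submodule F A :=
  (if i = 0 ∨ i = 1 then S.A0 else S.A1) ⊓
    LinearMap.ker (S.sharp - (if i = 0 ∨ i = 2 then (1 : F) else (-1 : F)) • LinearMap.id)

/-- A partition of `k`, given by its (non-increasing) sequence of row lengths. -/
structure NPartition (k : ℕ) where
  part : ℕ → ℕ
  antitone : Antitone part
  part_eq_zero : ∀ i, k ≤ i → part i = 0
  sum_eq : ∑ i ∈ Finset.range k, part i = k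

/-- The cells of the Young diagram of a partition. -/
abbrev NPartition.Cell {k : ℕ} (μ : NPartition k) : Type :=
  {p : ℕ × ℕ // p.2 < μ.part p.1}

/-- A Young tableau of shape `μ ⊢ k`: a bijective filling of the diagram with `1,…,k`. -/
abbrev YTableau {k : ℕ} (μ : NPartition k) : Type :=
  Fin k ≃ μ.Cell

/-- The row stabilizer of a tableau. -/
def rowStab {k : ℕ} {μ : NPartition k} (T : YTableau μ) : Set (Equiv.Perm (Fin k)) :=
  {π | ∀ a, (T (π a)).1.1 = (T a).1.1}

/-- The column stabilizer of a tableau. -/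
def colStab {k : ℕ} {μ : NPartition k} (T : YTableau μ) : Set (Equiv.Perm (Fin k)) :=
  {π | ∀ a, (T (π a)).1.2 = (T a).1.2}

/-- A standard Young tableau: entries increase along rows and down columns. -/
def YTableau.Standard {k : ℕ} {μ : NPartition k} (T : YTableau μ) : Prop :=
  ∀ c c' : μ.Cell,
    ((c.1.1 = c'.1.1 ∧ c.1.2 < c'.1.2) ∨ (c.1.2 = c'.1.2 ∧ c.1.1 < c'.1.1)) →
      T.symm c < T.symm c'

/-- The partition `μ` lies in the infinite hook `H(d,l)`, i.e. `μ_{d+1} ≤ l`. -/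
def InHook (d l : ℕ) {k : ℕ} (μ : NPartition k) : Prop :=
  μ.part d ≤ l

variable (F)

/-- The Young symmetrizer `e_T = ∑_{σ ∈ R_T, τ ∈ C_T} sgn(τ)·στ`. -/
def youngSym {k : ℕ} {μ : NPartition k} (T : YTableau μ) :
    MonoidAlgebra F (Equiv.Perm (Fin k)) :=
  ∑ σ ∈ Finset.univ.filter (· ∈ rowStab T),
    ∑ τ ∈ Finset.univ.filter (· ∈ colStab T),
      (Equiv.Perm.sign τ : ℤ) • MonoidAlgebra.single (σ * τ) (1 : F)

/-- The function `σ ↦ trace of left multiplication by `σ` on the left ideal generated by `e`;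
for `e` a Young symmetrizer of shape `λ` this is the irreducible character `χ_λ`. -/
def idealChar {k : ℕ} (e : MonoidAlgebra F (Equiv.Perm (Fin k)))
    (σ : Equiv.Perm (Fin k)) : F :=
  LinearMap.trace F _
    ((LinearMap.mulLeft F (MonoidAlgebra.single σ (1 : F))).restrict
      (p := (Submodule.span (MonoidAlgebra F (Equiv.Perm (Fin k))) {e}).restrictScalars F)
      (q := (Submodule.span (MonoidAlgebra F (Equiv.Perm (Fin k))) {e}).restrictScalars F)
      (fun x hx => by
        simp only [Submodule.restrictScalars_mem] at hx ⊢
        simpa [smul_eq_mul] using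
          (Submodule.span (MonoidAlgebra F (Equiv.Perm (Fin k))) {e}).smul_mem
            (MonoidAlgebra.single σ (1 : F)) hx))

/-- The set of variables for a multidegree `⟨n⟩ = (n₁,n₂,n₃,n₄)`: the disjoint union of
`Fin n₁, …, Fin n₄`, a type-`i` variable being evaluated in the `i`-th component. -/
abbrev MVar (n : Fin 4 → ℕ) : Type :=
  Σ i : Fin 4, Fin (n i)

/-- The group `S⟨n⟩ = S_{n₁} × S_{n₂} × S_{n₃} × S_{n₄}`. -/
abbrev MGroup (n : Fin 4 → ℕ) : Type :=
  ∀ i : Fin 4, Equiv.Perm (Fin (n i))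

/-- The space `P⟨n⟩` of multilinear `#`-superpolynomials: a function `c` represents
`∑_{ord} c(ord) x_{ord(1)} ⋯ x_{ord(n)}`. -/
abbrev MPoly (F : Type*) (n : Fin 4 → ℕ) : Type _ :=
  (Fin (∑ i, n i) ≃ MVar n) → F

variable {F} in
/-- The (left) action of `S⟨n⟩` on `P⟨n⟩` by relabeling the type-`i` variable indices. -/
def permMPoly {n : Fin 4 → ℕ} (g : MGroup n) (c : MPoly F n) : MPoly F n :=
  fun ord => c (ord.trans (Equiv.sigmaCongrRight fun i => ((g i)⁻¹ : Equiv.Perm (Fin (n i)))))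

variable {F} in
/-- `c ∈ P⟨n⟩` is a `#`-superidentity of `A`: every admissible evaluation
(type-`i` variables in the `i`-th component) vanishes. -/
def MIsIdentity {A : Type*} [NonUnitalRing A] [Module F A]
    [SMulCommClass F A A] [IsScalarTower F A A] (S : SuperAlg F A)
    {n : Fin 4 → ℕ} (c : MPoly F n) : Prop :=
  ∀ a : MVar n → A, (∀ v : MVar n, a v ∈ S.comp v.1) →
    ∑ ord : Fin (∑ i, n i) ≃ MVar n, c ord • finProd (fun j => a (ord j)) = 0

/-- The Young symmetrizer `e_{T⟨μ⟩}` of a Young multitableau, as an element of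
`FS⟨n⟩ = MonoidAlgebra F S⟨n⟩`. -/
def multiYoungSym {n : Fin 4 → ℕ} {μ : ∀ i : Fin 4, NPartition (n i)}
    (T : ∀ i : Fin 4, YTableau (μ i)) : MonoidAlgebra F (MGroup n) :=
  ∑ σ ∈ Finset.univ.filter (fun σ : MGroup n => ∀ i, σ i ∈ rowStab (T i)),
    ∑ τ ∈ Finset.univ.filter (fun τ : MGroup n => ∀ i, τ i ∈ colStab (T i)),
      (∏ i, (Equiv.Perm.sign (τ i) : ℤ)) • MonoidAlgebra.single (σ * τ) (1 : F)

/-- The element `e_{T⟨μ⟩} · f`, for `f ∈ P⟨n⟩`. -/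
def symAct {n : Fin 4 → ℕ} {μ : ∀ i : Fin 4, NPartition (n i)}
    (T : ∀ i : Fin 4, YTableau (μ i)) (c : MPoly F n) : MPoly F n :=
  ∑ σ ∈ Finset.univ.filter (fun σ : MGroup n => ∀ i, σ i ∈ rowStab (T i)),
    ∑ τ ∈ Finset.univ.filter (fun τ : MGroup n => ∀ i, τ i ∈ colStab (T i)),
      (∏ i, (Equiv.Perm.sign (τ i) : ℤ)) • permMPoly (σ * τ) c
variable {F} in
/-- `A` satisfies the Amitsur `#`-superidentity of rank
`⟨d,l⟩ = (d₁,l₁;d₂,l₂;d₃,l₃;d₄,l₄)` (here `dᵢ = d i`, `lᵢ = l i`): for each type `i`,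
with `kᵢ = (dᵢ+1)(lᵢ+1)`, `χᵢ` the irreducible character of the rectangular partition
`((lᵢ+1)^{dᵢ+1}) ⊢ kᵢ` (realized as the trace function on the left ideal generated by a
Young symmetrizer of that shape), every evaluation
`∑_{σ ∈ S_{kᵢ}} χᵢ(σ) b₁ a_{σ(1)} b₂ a_{σ(2)} ⋯ b_{kᵢ} a_{σ(kᵢ)} b_{kᵢ+1}`
vanishes, where `a₁,…,a_{kᵢ}` run over the `i`-th component and each `bⱼ` is either an
element of one of the four components or omitted. -/
def SatisfiesAmitsur {A : Type*} [NonUnitalRing A] [Module F A]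
    [SMulCommClass F A A] [IsScalarTower F A A] (S : SuperAlg F A)
    (d l : Fin 4 → ℕ) : Prop :=
  ∀ i : Fin 4, ∀ ν : NPartition ((d i + 1) * (l i + 1)),
    (∀ j, j < d i + 1 → ν.part j = l i + 1) →
    ∀ T : YTableau ν,
    ∀ a : Fin ((d i + 1) * (l i + 1)) → A, (∀ j, a j ∈ S.comp i) →
    ∀ b : Fin ((d i + 1) * (l i + 1) + 1) → Option A,
      (∀ j, ∀ x ∈ b j, ∃ t : Fin 4, x ∈ S.comp t) →
      ∑ σ : Equiv.Perm (Fin ((d i + 1) * (l i + 1))),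
        idealChar F (youngSym F T) σ •
          listProd ((List.ofFn fun j : Fin ((d i + 1) * (l i + 1)) =>
              (b j.castSucc).toList ++ [a (σ j)]).flatten ++ (b (Fin.last _)).toList) = 0

set_option linter.unusedSectionVars false
set_option linter.unusedSimpArgs false

set_option linter.unusedSectionVars false
set_option linter.unusedSimpArgs false

/-! ### Group algebra basics -/
section GAbasic
variable (F : Type*) [Field F]

abbrev GA (G : Type*) := MonoidAlgebra F G

def sg {G : Type*} (g : G) : GA F G := MonoidAlgebra.single g (1 : F)

variable {F}

lemma sg_mul {G : Type*} [Group G] (g h : G) : sg F (g * h) = sg F g * sg F h := by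
  simp [sg, MonoidAlgebra.single_mul_single]

lemma sg_one {G : Type*} [Group G] : sg F (1 : G) = 1 := rfl

lemma sg_coeff {G : Type*} (g h : G) : (sg F g).coeff h = if g = h then 1 else 0 := by
  simp [sg, Finsupp.single_apply]

lemma sg_expand {G : Type*} [Fintype G] (x : GA F G) : x = ∑ g, x.coeff g • sg F g := by
  ext h
  simp [sg]

lemma coeff_mul_sg {G : Type*} [Group G] (x : GA F G) (g h : G) :
    (x * sg F g).coeff h = x.coeff (h * g⁻¹) := by
  simp [sg]

lemma coeff_sg_mul {G : Type*} [Group G] (x : GA F G) (g h : G) :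
    (sg F g * x).coeff h = x.coeff (g⁻¹ * h) := by
  simp [sg]

lemma tau_comm {G : Type*} [Group G] [Fintype G] (x y : GA F G) :
    (x * y).coeff 1 = (y * x).coeff 1 := by
  rw [sg_expand y]
  simp only [Finset.mul_sum, Finset.sum_mul, MonoidAlgebra.coeff_sum, Finset.sum_apply',
    mul_smul_comm, smul_mul_assoc, MonoidAlgebra.coeff_smul, Finsupp.smul_apply, coeff_mul_sg,
    coeff_sg_mul, one_mul, mul_one]

end GAbasic

section Sym
variable (F : Type*) [Field F] {α : Type*} [Fintype α] [DecidableEq α]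

def keyGrp (κ : α → ℕ) (D : Finset α) : Finset (Equiv.Perm α) :=
  Finset.univ.filter (fun σ => (∀ x, κ (σ x) = κ x) ∧ ∀ x, x ∉ D → σ x = x)

variable {F}
lemma mem_keyGrp {κ : α → ℕ} {D : Finset α} {σ : Equiv.Perm α} :
    σ ∈ keyGrp κ D ↔ (∀ x, κ (σ x) = κ x) ∧ ∀ x, x ∉ D → σ x = x := by simp [keyGrp]

lemma keyGrp_mul {κ : α → ℕ} {D : Finset α} {σ τ : Equiv.Perm α} (hσ : σ ∈ keyGrp κ D)
    (hτ : τ ∈ keyGrp κ D) : σ * τ ∈ keyGrp κ D := by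
  rw [mem_keyGrp] at *
  refine ⟨fun x => ?_, fun x hx => ?_⟩
  · rw [Equiv.Perm.mul_apply, hσ.1, hτ.1]
  · rw [Equiv.Perm.mul_apply, hτ.2 x hx, hσ.2 x hx]

lemma keyGrp_inv {κ : α → ℕ} {D : Finset α} {σ : Equiv.Perm α} (hσ : σ ∈ keyGrp κ D) :
    σ⁻¹ ∈ keyGrp κ D := by
  rw [mem_keyGrp] at *
  refine ⟨fun x => ?_, fun x hx => ?_⟩
  · have := hσ.1 (σ⁻¹ x); simpa using this.symm
  · rw [Equiv.Perm.inv_eq_iff_eq]; exact (hσ.2 x hx).symm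

lemma keyGrp_one {κ : α → ℕ} {D : Finset α} : (1 : Equiv.Perm α) ∈ keyGrp κ D := by
  rw [mem_keyGrp]; simp

lemma keyGrp_swap {κ : α → ℕ} {D : Finset α} {p q : α} (hp : p ∈ D) (hq : q ∈ D)
    (h : κ p = κ q) : Equiv.swap p q ∈ keyGrp κ D := by
  rw [mem_keyGrp]
  refine ⟨fun x => ?_, fun x hx => ?_⟩
  · rw [Equiv.swap_apply_def]; split_ifs with h1 h2 <;> simp_all
  · apply Equiv.swap_apply_of_ne_of_ne <;> rintro rfl <;> contradiction

variable (F)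
def symS (κ : α → ℕ) (ε : Equiv.Perm α →* ℤˣ) (D : Finset α) : GA F (Equiv.Perm α) :=
  ∑ σ ∈ keyGrp κ D, ((ε σ : ℤ) : F) • sg F σ
variable {F}

lemma eps_mul_self (u : ℤˣ) : ((u : ℤ) : F) * ((u : ℤ) : F) = 1 := by
  rcases Int.units_eq_one_or u with rfl | rfl <;> simp

lemma symS_mul_sg {κ : α → ℕ} {ε : Equiv.Perm α →* ℤˣ} {D : Finset α} {s : Equiv.Perm α}
    (hs : s ∈ keyGrp κ D) : symS F κ ε D * sg F s = ((ε s : ℤ) : F) • symS F κ ε D := by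
  unfold symS
  rw [Finset.sum_mul, Finset.smul_sum]
  refine Finset.sum_bij' (fun σ _ => σ * s) (fun σ _ => σ * s⁻¹)
    (fun σ h => keyGrp_mul h hs) (fun σ h => keyGrp_mul h (keyGrp_inv hs))
    (by simp) (by simp) ?_
  intro σ _
  rw [smul_mul_assoc, ← sg_mul, smul_smul, map_mul]
  congr 1
  push_cast
  rw [mul_left_comm, eps_mul_self, mul_one]

lemma sg_mul_symS {κ : α → ℕ} {ε : Equiv.Perm α →* ℤˣ} {D : Finset α} {s : Equiv.Perm α}
    (hs : s ∈ keyGrp κ D) : sg F s * symS F κ ε D = ((ε s : ℤ) : F) • symS F κ ε D := by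
  unfold symS
  rw [Finset.mul_sum, Finset.smul_sum]
  refine Finset.sum_bij' (fun σ _ => s * σ) (fun σ _ => s⁻¹ * σ)
    (fun σ h => keyGrp_mul hs h) (fun σ h => keyGrp_mul (keyGrp_inv hs) h)
    (by simp) (by simp) ?_
  intro σ _
  rw [mul_smul_comm, ← sg_mul, smul_smul, map_mul]
  congr 1
  push_cast
  rw [← mul_assoc, eps_mul_self, one_mul]

lemma eq_zero_of_eq_neg_F [CharZero F] {M : Type*} [AddCommGroup M] [Module F M] {x : M}
    (h : x = -x) : x = 0 := by
  have h2 : (2 : F) • x = 0 := by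
    rw [two_smul]; nth_rewrite 1 [h]; exact neg_add_cancel x
  exact (smul_eq_zero.mp h2).resolve_left two_ne_zero

/-- the transposition argument -/
lemma sandwich_zero [CharZero F] {κ κ' : α → ℕ} {ε ε' : Equiv.Perm α →* ℤˣ} {D D' : Finset α}
    (g : Equiv.Perm α) {p q : α} (hp : g p ∈ D) (hq : g q ∈ D) (hp' : p ∈ D') (hq' : q ∈ D')
    (h : κ (g p) = κ (g q)) (h' : κ' p = κ' q)
    (he : ε (Equiv.swap (g p) (g q)) = - ε' (Equiv.swap p q)) :
    symS F κ ε D * sg F g * symS F κ' ε' D' = 0 := by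
  have h1 := symS_mul_sg (F := F) (ε := ε) (keyGrp_swap hp hq h)
  have h2 := sg_mul_symS (F := F) (ε := ε') (keyGrp_swap hp' hq' h')
  have h3 : Equiv.swap (g p) (g q) * g = g * Equiv.swap p q := by
    rw [Equiv.mul_swap_eq_swap_mul]
  have h4 : symS F κ ε D * sg F (Equiv.swap (g p) (g q)) * sg F g * symS F κ' ε' D' =
      symS F κ ε D * sg F g * (sg F (Equiv.swap p q) * symS F κ' ε' D') := by
    rw [mul_assoc (symS F κ ε D), ← sg_mul, h3, sg_mul]; simp only [mul_assoc]
  rw [h1, h2, smul_mul_assoc, smul_mul_assoc, mul_smul_comm, he] at h4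
  rcases Int.units_eq_one_or (ε' (Equiv.swap p q)) with hu | hu <;> rw [hu] at h4
  · simp only [Units.val_neg, Units.val_one, Int.cast_neg, Int.cast_one, neg_smul, one_smul] at h4
    exact eq_zero_of_eq_neg_F (F := F) h4.symm
  · simp only [Units.val_neg, Units.val_one, neg_neg, Int.cast_neg, Int.cast_one, neg_smul, one_smul] at h4
    exact eq_zero_of_eq_neg_F (F := F) h4

lemma symS_empty {κ : α → ℕ} {ε : Equiv.Perm α →* ℤˣ} : symS F κ ε ∅ = 1 := by
  have : keyGrp κ (∅ : Finset α) = {1} := by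
    ext σ
    rw [mem_keyGrp, Finset.mem_singleton]
    constructor
    · rintro ⟨-, h⟩; ext x; simpa using h x (by simp)
    · rintro rfl; simp
  rw [symS, this, Finset.sum_singleton, map_one]
  simp [sg_one]

lemma keyGrp_mono {κ : α → ℕ} {D D' : Finset α} (h : D ⊆ D') : keyGrp κ D ⊆ keyGrp κ D' := by
  intro σ; rw [mem_keyGrp, mem_keyGrp]; exact fun ⟨a, b⟩ => ⟨a, fun x hx => b x fun hh => hx (h hh)⟩

lemma symS_insert {κ : α → ℕ} {ε : Equiv.Perm α →* ℤˣ} {D : Finset α} {a : α} (ha : a ∉ D) :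
    symS F κ ε (insert a D) = symS F κ ε D *
      (1 + ∑ j ∈ D.filter (fun j => κ j = κ a),
        ((ε (Equiv.swap j a) : ℤ) : F) • sg F (Equiv.swap j a)) := by
  have h1 : (1 : GA F (Equiv.Perm α)) + ∑ j ∈ D.filter (fun j => κ j = κ a),
        ((ε (Equiv.swap j a) : ℤ) : F) • sg F (Equiv.swap j a) =
      ∑ j ∈ (insert a D).filter (fun j => κ j = κ a),
        ((ε (Equiv.swap j a) : ℤ) : F) • sg F (Equiv.swap j a) := by
    rw [Finset.filter_insert, if_pos rfl, Finset.sum_insert (by simp [ha]), Equiv.swap_self]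
    congr 1
    have : (Equiv.refl α : Equiv.Perm α) = 1 := rfl
    rw [this, map_one]; simp [sg_one]
  rw [h1]
  unfold symS
  rw [Finset.sum_mul_sum, ← Finset.sum_product']
  symm
  have hsw : ∀ j ∈ (insert a D).filter (fun j => κ j = κ a),
      Equiv.swap j a ∈ keyGrp κ (insert a D) := by
    intro j hj
    rw [Finset.mem_filter] at hj
    exact keyGrp_swap hj.1 (by simp) hj.2
  refine Finset.sum_bij' (fun p _ => p.1 * Equiv.swap p.2 a)
    (fun σ _ => (σ * Equiv.swap (σ⁻¹ a) a, σ⁻¹ a)) ?_ ?_ ?_ ?_ ?_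
  · rintro ⟨σ, j⟩ h
    rw [Finset.mem_product] at h
    exact keyGrp_mul (keyGrp_mono (Finset.subset_insert _ _) h.1) (hsw j h.2)
  · intro σ h
    have hi := keyGrp_inv h
    have hj : σ⁻¹ a ∈ (insert a D).filter (fun j => κ j = κ a) := by
      rw [Finset.mem_filter]
      refine ⟨?_, (mem_keyGrp.1 hi).1 a⟩
      by_contra hn
      have h2 := (mem_keyGrp.1 h).2 _ hn
      rw [show σ (σ⁻¹ a) = a from σ.apply_symm_apply a] at h2
      rw [← h2] at hn; simp at hn
    rw [Finset.mem_product]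
    refine ⟨?_, hj⟩
    have h3 := keyGrp_mul h (hsw _ hj)
    rw [mem_keyGrp] at h3 ⊢
    refine ⟨h3.1, fun x hx => ?_⟩
    by_cases hxa : x = a
    · subst hxa; simp
    · exact h3.2 x (by simp [hx, hxa])
  · rintro ⟨σ, j⟩ h
    rw [Finset.mem_product] at h
    have h0 : σ a = a := (mem_keyGrp.1 h.1).2 a ha
    have h1 : σ⁻¹ a = a := by rw [Equiv.Perm.inv_eq_iff_eq, h0]
    have h2 : (σ * Equiv.swap j a)⁻¹ a = j := by
      rw [mul_inv_rev, Equiv.swap_inv, Equiv.Perm.mul_apply, h1, Equiv.swap_apply_right]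
    simp only [h2, Prod.mk.injEq, and_true]
    rw [mul_assoc, Equiv.swap_mul_self, mul_one]
  · intro σ h
    simp only
    rw [mul_assoc, Equiv.swap_mul_self, mul_one]
  · rintro ⟨σ, j⟩ h
    simp only
    rw [smul_mul_smul_comm, ← sg_mul, map_mul]
    push_cast; rfl

/-- the antiautomorphism `g ↦ g⁻¹` fixes `symS`; expressed through the left version. -/
lemma symS_insert_left {κ : α → ℕ} {ε : Equiv.Perm α →* ℤˣ} {D : Finset α} {a : α} (ha : a ∉ D) :
    symS F κ ε (insert a D) = 
      (1 + ∑ j ∈ D.filter (fun j => κ j = κ a),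
        ((ε (Equiv.swap j a) : ℤ) : F) • sg F (Equiv.swap j a)) * symS F κ ε D := by
  rw [symS_insert ha]
  rw [mul_add, add_mul, mul_one, one_mul]
  congr 1
  rw [Finset.mul_sum, Finset.sum_mul]
  unfold symS
  simp_rw [Finset.sum_mul, Finset.mul_sum]
  rw [Finset.sum_comm]
  conv_rhs => rw [Finset.sum_comm]
  refine Finset.sum_congr rfl fun σ hσ => ?_
  have hs := mem_keyGrp.1 hσ
  have hs' := mem_keyGrp.1 (keyGrp_inv hσ)
  have hmem : ∀ τ ∈ keyGrp κ D, ∀ j ∈ D.filter (fun j => κ j = κ a),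
      τ j ∈ D.filter (fun j => κ j = κ a) := by
    intro τ hτ j hj
    rw [Finset.mem_filter] at hj ⊢
    refine ⟨?_, by rw [(mem_keyGrp.1 hτ).1]; exact hj.2⟩
    by_contra hn
    have := (mem_keyGrp.1 (keyGrp_inv hτ)).2 _ hn
    rw [show τ⁻¹ (τ j) = j from τ.symm_apply_apply j] at this
    rw [← this] at hn; exact hn hj.1
  refine Finset.sum_bij' (fun j _ => σ j) (fun j _ => σ⁻¹ j) (hmem σ hσ)
    (hmem _ (keyGrp_inv hσ)) (by simp) (by simp) ?_
  intro j hj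
  have ha' : σ a = a := hs.2 a ha
  have h3 : σ * Equiv.swap j a = Equiv.swap (σ j) a * σ := by
    rw [Equiv.mul_swap_eq_swap_mul, ha']
  rw [smul_mul_smul_comm, smul_mul_smul_comm, ← sg_mul, ← sg_mul, h3]
  congr 1
  rw [← Int.cast_mul, ← Int.cast_mul, ← Units.val_mul, ← Units.val_mul, ← map_mul, ← map_mul, h3]

end Sym



/-! ### Jucys–Murphy elements -/
section JM
variable (F : Type*) [Field F] {α : Type*} [Fintype α] [DecidableEq α]

def jm (L : List α) (a : α) : GA F (Equiv.Perm α) := (L.map fun j => sg F (Equiv.swap j a)).sum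

def zz (t : F) : List α → GA F (Equiv.Perm α)
  | [] => 1
  | a :: L => zz t L * (t • 1 + jm F L a)

variable {F}

lemma jm_eq_sum {L : List α} (h : L.Nodup) (a : α) :
    jm F L a = ∑ j ∈ L.toFinset, sg F (Equiv.swap j a) := by
  rw [jm, List.sum_toFinset _ h]

lemma jm_perm {L L' : List α} (h : L.Perm L') (a : α) : jm F L a = jm F L' a :=
  (h.map _).sum_eq

lemma jm_comm {L : List α} (hL : L.Nodup) {a b : α} (hab : a ≠ b) (ha : a ∉ L) (hb : b ∉ L) :
    jm F L b * jm F L a + jm F L b * sg F (Equiv.swap a b) =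
      jm F L a * jm F L b + jm F L a * sg F (Equiv.swap a b) := by
  rw [jm_eq_sum hL, jm_eq_sum hL]
  have hne : ∀ j ∈ L.toFinset, j ≠ a ∧ j ≠ b := by
    intro j hj
    rw [List.mem_toFinset] at hj
    exact ⟨fun h => ha (h ▸ hj), fun h => hb (h ▸ hj)⟩
  have h1 : ∀ j ∈ L.toFinset, Equiv.swap j a * Equiv.swap a b = Equiv.swap j b * Equiv.swap j a := by
    intro j hj
    obtain ⟨h1, h2⟩ := hne j hj
    rw [Equiv.mul_swap_eq_swap_mul, Equiv.swap_apply_right, Equiv.swap_apply_of_ne_of_ne h2.symm hab.symm]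
  have h2 : ∀ j ∈ L.toFinset, Equiv.swap j b * Equiv.swap a b = Equiv.swap j a * Equiv.swap j b := by
    intro j hj
    obtain ⟨h1, h2⟩ := hne j hj
    rw [Equiv.mul_swap_eq_swap_mul, Equiv.swap_apply_right, Equiv.swap_apply_of_ne_of_ne h1.symm hab,
      Equiv.swap_comm a j]
  have h3 : (∑ j ∈ L.toFinset, sg F (Equiv.swap j b)) * (∑ j ∈ L.toFinset, sg F (Equiv.swap j a))
     - (∑ j ∈ L.toFinset, sg F (Equiv.swap j a)) * (∑ j ∈ L.toFinset, sg F (Equiv.swap j b))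
     = ∑ j ∈ L.toFinset, (sg F (Equiv.swap j b * Equiv.swap j a) - sg F (Equiv.swap j a * Equiv.swap j b)) := by
    rw [Finset.sum_mul_sum, Finset.sum_mul_sum]
    rw [Finset.sum_comm (f := fun i j => sg F (Equiv.swap i a) * sg F (Equiv.swap j b))]
    rw [← Finset.sum_sub_distrib]
    refine Finset.sum_congr rfl fun j hj => ?_
    rw [← Finset.sum_sub_distrib]
    rw [Finset.sum_eq_single j]
    · simp [sg_mul]
    · intro k hk hkj
      rw [← sg_mul, ← sg_mul, sub_eq_zero]
      congr 1
      obtain ⟨hk1, hk2⟩ := hne k hk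
      obtain ⟨hj1, hj2⟩ := hne j hj
      rw [Equiv.mul_swap_eq_swap_mul, Equiv.swap_apply_of_ne_of_ne hkj hk2,
        Equiv.swap_apply_of_ne_of_ne hj1.symm hab]
    · exact fun h => absurd hj h
  have h4 : (∑ j ∈ L.toFinset, sg F (Equiv.swap j b)) * sg F (Equiv.swap a b) =
      ∑ j ∈ L.toFinset, sg F (Equiv.swap j a * Equiv.swap j b) := by
    rw [Finset.sum_mul]; exact Finset.sum_congr rfl fun j hj => by rw [← sg_mul, h2 j hj]
  have h5 : (∑ j ∈ L.toFinset, sg F (Equiv.swap j a)) * sg F (Equiv.swap a b) =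
      ∑ j ∈ L.toFinset, sg F (Equiv.swap j b * Equiv.swap j a) := by
    rw [Finset.sum_mul]; exact Finset.sum_congr rfl fun j hj => by rw [← sg_mul, h1 j hj]
  rw [Finset.sum_sub_distrib] at h3
  rw [h4, h5]
  rw [sub_eq_sub_iff_add_eq_add] at h3
  rw [h3, add_comm]

lemma zz_perm (t : F) {L L' : List α} (h : L.Perm L') (hL : L.Nodup) : zz F t L = zz F t L' := by
  induction h with
  | nil => rfl
  | cons a h ih =>
    rw [List.nodup_cons] at hL
    rw [zz, zz, ih hL.2, jm_perm h]
  | swap a b L =>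
    simp only [List.nodup_cons, List.mem_cons, not_or] at hL
    obtain ⟨⟨hba, hbL⟩, haL, hL⟩ := hL
    have h := jm_comm (F := F) hL (Ne.symm hba) haL hbL
    simp only [zz, mul_assoc]
    congr 1
    have e1 : jm F (a :: L) b = sg F (Equiv.swap a b) + jm F L b := by simp [jm]
    have e2 : jm F (b :: L) a = sg F (Equiv.swap a b) + jm F L a := by
      simp [jm, Equiv.swap_comm b a]
    rw [e1, e2]
    simp only [add_mul, mul_add, smul_mul_assoc, mul_smul_comm, one_mul, mul_one, smul_add]
    rw [← sub_eq_zero] at h ⊢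
    rw [← neg_eq_zero, ← h]
    abel
  | trans h1 h2 ih1 ih2 => rw [ih1 hL, ih2 (h1.nodup_iff.1 hL)]

lemma sg_mul_jm (g : Equiv.Perm α) (L : List α) (a : α) :
    sg F g * jm F L a = jm F (L.map g) (g a) * sg F g := by
  induction L with
  | nil => simp [jm]
  | cons b L ih =>
    simp only [jm, List.map_cons, List.sum_cons, mul_add, add_mul] at ih ⊢
    rw [ih]
    congr 1
    rw [← sg_mul, ← sg_mul, Equiv.mul_swap_eq_swap_mul]

lemma sg_mul_zz (t : F) (g : Equiv.Perm α) (L : List α) :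
    sg F g * zz F t L = zz F t (L.map g) * sg F g := by
  induction L with
  | nil => simp [zz]
  | cons b L ih =>
    simp only [zz, List.map_cons]
    rw [← mul_assoc, ih, mul_assoc, mul_assoc, mul_add, add_mul, sg_mul_jm]
    simp

lemma map_perm_of_fix {L : List α} (hL : L.Nodup) {g : Equiv.Perm α} (hg : ∀ x, x ∉ L → g x = x) :
    (L.map g).Perm L := by
  rw [List.perm_ext_iff_of_nodup (hL.map g.injective) hL]
  intro x
  rw [List.mem_map]
  constructor
  · rintro ⟨y, hy, rfl⟩
    by_contra hn
    have := g.injective (hg _ hn)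
    rw [this] at hn; exact hn hy
  · intro hx
    refine ⟨g⁻¹ x, ?_, g.apply_symm_apply x⟩
    by_contra hn
    have := hg _ hn
    rw [show g (g⁻¹ x) = x from g.apply_symm_apply x] at this
    rw [← this] at hn; exact hn hx

lemma zz_commute (t : F) {L : List α} (hL : L.Nodup) {g : Equiv.Perm α} (hg : ∀ x, x ∉ L → g x = x) :
    sg F g * zz F t L = zz F t L * sg F g := by
  rw [sg_mul_zz, zz_perm t (map_perm_of_fix hL hg) (hL.map g.injective)]

lemma jm_commute {L : List α} (hL : L.Nodup) {a : α} {g : Equiv.Perm α}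
    (hg : ∀ x, x ∉ L → g x = x) (ha : a ∉ L) :
    sg F g * jm F L a = jm F L a * sg F g := by
  rw [sg_mul_jm, jm_perm (map_perm_of_fix hL hg), hg a ha]

/-- the subalgebra spanned by the permutations fixing `a` -/
def fixAlg (a : α) : Subalgebra F (GA F (Equiv.Perm α)) where
  carrier := {x | ∀ g : Equiv.Perm α, g a ≠ a → x.coeff g = 0}
  mul_mem' := by
    intro x y hx hy g hg
    rw [sg_expand x, Finset.sum_mul, MonoidAlgebra.coeff_sum, Finset.sum_apply']
    refine Finset.sum_eq_zero fun h _ => ?_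
    rw [smul_mul_assoc, MonoidAlgebra.coeff_smul, Finsupp.smul_apply, coeff_sg_mul, smul_eq_mul]
    by_cases hh : h a = a
    · rw [hy, mul_zero]
      intro h2
      rw [Equiv.Perm.mul_apply, Equiv.Perm.inv_eq_iff_eq] at h2
      exact hg (h2.trans hh)
    · rw [hx h hh, zero_mul]
  add_mem' := by
    intro x y hx hy g hg
    simp [hx g hg, hy g hg]
  algebraMap_mem' := by
    intro r g hg
    rw [Algebra.algebraMap_eq_smul_one, ← sg_one, MonoidAlgebra.coeff_smul, Finsupp.smul_apply,
      sg_coeff, if_neg, smul_zero]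
    rintro rfl; exact hg rfl

lemma sg_mem_fix {a : α} {g : Equiv.Perm α} (h : g a = a) : sg F g ∈ fixAlg (F := F) a := by
  intro k hk
  rw [sg_coeff, if_neg]; rintro rfl; exact hk h

lemma symS_mem_fix {a : α} {κ : α → ℕ} {ε : Equiv.Perm α →* ℤˣ} {D : Finset α} (h : a ∉ D) :
    symS F κ ε D ∈ fixAlg (F := F) a := by
  refine Subalgebra.sum_mem _ fun σ hσ => Subalgebra.smul_mem _ (sg_mem_fix ?_) _
  exact (mem_keyGrp.1 hσ).2 a h

lemma jm_mem_fix {a : α} {L : List α} {b : α} (hb : b ≠ a) (h : a ∉ L) :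
    jm F L b ∈ fixAlg (F := F) a := by
  refine list_sum_mem fun x hx => ?_
  rw [List.mem_map] at hx
  obtain ⟨j, hj, rfl⟩ := hx
  refine sg_mem_fix (Equiv.swap_apply_of_ne_of_ne ?_ hb.symm)
  rintro rfl; exact h hj

lemma zz_mem_fix (t : F) {a : α} {L : List α} (h : a ∉ L) : zz F t L ∈ fixAlg (F := F) a := by
  induction L with
  | nil => exact Subalgebra.one_mem _
  | cons b L ih =>
    simp only [List.mem_cons, not_or] at h
    exact Subalgebra.mul_mem _ (ih h.2) (Subalgebra.add_mem _
      (Subalgebra.smul_mem _ (Subalgebra.one_mem _) _) (jm_mem_fix (Ne.symm h.1) h.2))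

lemma corner_step [CharZero F] (t : F) {row col : α → ℕ}
    (hinj : ∀ x y, row x = row y → col x = col y → x = y)
    {a : α} {L : List α} (hL : (a :: L).Nodup)
    (H : ∀ j ∈ L, ∀ b ∈ L, row j = row a → col b = col a → ∃ q ∈ L, row q = row b ∧ col q = col j) :
    (zz F t (a :: L) * (symS F row 1 (a :: L).toFinset *
      symS F col Equiv.Perm.sign (a :: L).toFinset)).coeff 1 =
    (t + ((L.toFinset.filter (fun j => row j = row a)).card : F) -
      ((L.toFinset.filter (fun j => col j = col a)).card : F)) *
    (zz F t L * (symS F row 1 L.toFinset * symS F col Equiv.Perm.sign L.toFinset)).coeff 1 := by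
  rw [List.nodup_cons] at hL
  obtain ⟨haL, hL⟩ := hL
  have haD : a ∉ L.toFinset := by rwa [List.mem_toFinset]
  set D := L.toFinset with hD
  rw [List.toFinset_cons, symS_insert haD, symS_insert_left haD]
  set R := symS F row 1 D with hR
  set C := symS F col Equiv.Perm.sign D with hC
  set Dr := D.filter (fun j => row j = row a) with hDr
  set Dc := D.filter (fun j => col j = col a) with hDc
  rw [zz]
  set Z := zz F t L
  set X := jm F L a with hX
  have hXs : X = ∑ j ∈ D, sg F (Equiv.swap j a) := jm_eq_sum hL a
  have hne : ∀ j ∈ D, j ≠ a := fun j hj h => haD (h ▸ hj)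
  have hA : (∑ j ∈ Dr, (((1 : Equiv.Perm α →* ℤˣ) (Equiv.swap j a) : ℤ) : F) • sg F (Equiv.swap j a))
      = ∑ j ∈ Dr, sg F (Equiv.swap j a) := by
    refine Finset.sum_congr rfl fun j _ => by simp
  have hB : (∑ j ∈ Dc, ((Equiv.Perm.sign (Equiv.swap j a) : ℤ) : F) • sg F (Equiv.swap j a))
      = - ∑ j ∈ Dc, sg F (Equiv.swap j a) := by
    rw [← Finset.sum_neg_distrib]
    refine Finset.sum_congr rfl fun j hj => ?_
    rw [Equiv.Perm.sign_swap (hne j (Finset.mem_filter.1 hj).1)]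
    simp
  rw [hA, hB]
  set A := ∑ j ∈ Dr, sg F (Equiv.swap j a) with hAd
  set B := ∑ j ∈ Dc, sg F (Equiv.swap j a) with hBd
  have hXR : X * R = R * X := by
    rw [hR, symS, Finset.sum_mul, Finset.mul_sum]
    refine Finset.sum_congr rfl fun σ hσ => ?_
    rw [smul_mul_assoc, mul_smul_comm, hX, jm_commute hL _ haL]
    intro x hx
    exact (mem_keyGrp.1 hσ).2 x (by rwa [hD, List.mem_toFinset])
  have hW : C * Z * R ∈ fixAlg (F := F) a :=
    Subalgebra.mul_mem _ (Subalgebra.mul_mem _ (symS_mem_fix haD) (zz_mem_fix t haL))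
      (symS_mem_fix haD)
  let φ : GA F (Equiv.Perm α) →ₗ[F] F :=
    { toFun := fun x => (C * Z * R * x).coeff 1
      map_add' := by intro x y; simp [mul_add]
      map_smul' := by intro x y; simp }
  have hφ0 : ∀ g : Equiv.Perm α, g a ≠ a → φ (sg F g) = 0 := by
    intro g hg
    change (C * Z * R * sg F g).coeff 1 = 0
    rw [coeff_mul_sg, one_mul]
    apply hW
    rw [ne_eq, Equiv.Perm.inv_eq_iff_eq]; exact fun h => hg h.symm
  have hφ1 : φ 1 = (Z * (R * C)).coeff 1 := by
    change (C * Z * R * 1).coeff 1 = _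
    rw [mul_one, mul_assoc, tau_comm, mul_assoc]
  have key : (Z * (t • 1 + X) * (R * (1 + A) * ((1 + -B) * C))).coeff 1 =
      φ ((t • 1 + X) * ((1 + A) * (1 + -B))) := by
    change _ = (C * Z * R * _).coeff 1
    have : Z * (t • 1 + X) * (R * (1 + A) * ((1 + -B) * C)) =
      (Z * R * ((t • 1 + X) * ((1 + A) * (1 + -B)))) * C := by
      have h2 : (t • 1 + X) * R = R * (t • 1 + X) := by
        rw [add_mul, mul_add, hXR]; simp
      calc _ = Z * ((t • 1 + X) * R) * ((1 + A) * (1 + -B)) * C := by simp only [mul_assoc]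
        _ = _ := by rw [h2]; simp only [mul_assoc]
    rw [this, tau_comm]
    simp only [mul_assoc]
  rw [key, ← hφ1]
  have hDrD : ∀ j ∈ Dr, j ∈ D ∧ row j = row a := fun j hj => Finset.mem_filter.1 hj
  have hDcD : ∀ j ∈ Dc, j ∈ D ∧ col j = col a := fun j hj => Finset.mem_filter.1 hj
  have hsw : ∀ j ∈ D, φ (sg F (Equiv.swap j a)) = 0 := by
    intro j hj; apply hφ0; rw [Equiv.swap_apply_right]; exact hne j hj
  have eA : φ A = 0 := by
    rw [hAd, map_sum]; exact Finset.sum_eq_zero fun j hj => hsw j (hDrD j hj).1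
  have eB : φ B = 0 := by
    rw [hBd, map_sum]; exact Finset.sum_eq_zero fun j hj => hsw j (hDcD j hj).1
  have eX : φ X = 0 := by
    rw [hXs, map_sum]; exact Finset.sum_eq_zero fun j hj => hsw j hj
  have eXS : ∀ D' : Finset α, D' ⊆ D → φ (X * ∑ j ∈ D', sg F (Equiv.swap j a)) = (D'.card : F) * φ 1 := by
    intro D' hD'
    rw [hXs, Finset.sum_mul_sum, Finset.sum_comm, map_sum]
    rw [Finset.sum_congr rfl (g := fun _ => φ 1)]
    · simp
    · intro j hj
      rw [map_sum, Finset.sum_eq_single j]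
      · rw [← sg_mul, Equiv.swap_mul_self, sg_one]
      · intro x hx hxj
        rw [← sg_mul]
        apply hφ0
        rw [Equiv.Perm.mul_apply, Equiv.swap_apply_right,
          Equiv.swap_apply_of_ne_of_ne hxj.symm (hne j (hD' hj))]
        exact hne j (hD' hj)
      · exact fun h => absurd (hD' hj) h
  have eXA : φ (X * A) = (Dr.card : F) * φ 1 := eXS Dr (Finset.filter_subset _ _)
  have eXB : φ (X * B) = (Dc.card : F) * φ 1 := eXS Dc (Finset.filter_subset _ _)
  have hjb : ∀ j ∈ Dr, ∀ b ∈ Dc, b ≠ j := by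
    rintro j hj _ hb rfl
    exact hne _ (hDrD _ hj).1 (hinj _ _ (hDrD _ hj).2 (hDcD _ hb).2)
  have eAB : φ (A * B) = 0 := by
    rw [hAd, hBd, Finset.sum_mul_sum, map_sum]
    refine Finset.sum_eq_zero fun j hj => ?_
    rw [map_sum]
    refine Finset.sum_eq_zero fun b hb => ?_
    rw [← sg_mul]
    apply hφ0
    rw [Equiv.Perm.mul_apply, Equiv.swap_apply_right,
      Equiv.swap_apply_of_ne_of_ne (hjb j hj b hb) (hne b (hDcD b hb).1)]
    exact hne b (hDcD b hb).1
  have eXAB : φ (X * (A * B)) = 0 := by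
    rw [hXs, hAd, hBd, Finset.sum_mul_sum, Finset.sum_mul, map_sum]
    refine Finset.sum_eq_zero fun x hx => ?_
    rw [Finset.mul_sum, map_sum]
    refine Finset.sum_eq_zero fun j hj => ?_
    rw [Finset.mul_sum, map_sum]
    refine Finset.sum_eq_zero fun b hb => ?_
    rw [← sg_mul, ← sg_mul]
    have hba := hne b (hDcD b hb).1
    have hja := hne j (hDrD j hj).1
    have hbj := hjb j hj b hb
    by_cases hxb : x = b
    · subst hxb
      have e : Equiv.swap x a * (Equiv.swap j a * Equiv.swap x a) = Equiv.swap j x := by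
        have e0 : Equiv.swap x a * Equiv.swap j a = Equiv.swap j x * Equiv.swap x a := by
          rw [Equiv.mul_swap_eq_swap_mul, Equiv.swap_apply_right,
            Equiv.swap_apply_of_ne_of_ne hbj.symm hja]
        rw [← mul_assoc, e0, mul_assoc, Equiv.swap_mul_self, mul_one]
      rw [e]
      change (C * Z * R * sg F (Equiv.swap j x)).coeff 1 = 0
      rw [mul_assoc, mul_assoc, tau_comm, mul_assoc, mul_assoc, ← mul_assoc R]
      have hz : R * sg F (Equiv.swap j x) * C = 0 := by
        obtain ⟨hjD, hjr⟩ := hDrD j hj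
        obtain ⟨hbD, hbc⟩ := hDcD x hb
        obtain ⟨q, hq, hq1, hq2⟩ := H j (List.mem_toFinset.1 hjD) x (List.mem_toFinset.1 hbD) hjr hbc
        have hqD : q ∈ D := List.mem_toFinset.2 hq
        have hqj : q ≠ j := by
          rintro rfl
          exact hba (hinj _ _ (hq1.symm.trans hjr) hbc)
        have hqx : q ≠ x := by
          rintro rfl
          exact hja (hinj _ _ hjr (hq2.symm.trans hbc))
        have g1 : Equiv.swap j x j = x := Equiv.swap_apply_left _ _
        have g2 : Equiv.swap j x q = q := Equiv.swap_apply_of_ne_of_ne hqj hqx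
        refine sandwich_zero (p := j) (q := q) _ ?_ ?_ hjD hqD ?_ hq2.symm ?_
        · rwa [g1]
        · rwa [g2]
        · rw [g1, g2, hq1]
        · rw [Equiv.Perm.sign_swap hqj.symm]; simp
      rw [hz]; simp
    · apply hφ0
      rw [Equiv.Perm.mul_apply, Equiv.Perm.mul_apply, Equiv.swap_apply_right,
        Equiv.swap_apply_of_ne_of_ne hbj hba, Equiv.swap_apply_of_ne_of_ne (Ne.symm hxb) hba]
      exact hba
  have expand : (t • 1 + X) * ((1 + A) * (1 + -B)) =
      t • 1 + t • A - t • B - t • (A * B) + X + X * A - X * B - X * (A * B) := by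
    simp only [add_mul, mul_add, smul_mul_assoc, one_mul, mul_one, mul_neg, smul_add, smul_neg]
    abel
  rw [expand]
  simp only [map_add, map_sub, map_smul, eA, eB, eX, eXA, eXB, eAB, eXAB, smul_eq_mul]
  ring

end JM


/-! ### Young symmetrizers: contents and orthogonality -/
section Young
variable {F : Type*} [Field F]

def rowF {k : ℕ} {μ : NPartition k} (T : YTableau μ) (x : Fin k) : ℕ := (T x).1.1
def colF {k : ℕ} {μ : NPartition k} (T : YTableau μ) (x : Fin k) : ℕ := (T x).1.2

lemma rowF_colF_inj {k : ℕ} {μ : NPartition k} (T : YTableau μ) (x y : Fin k)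
    (h1 : rowF T x = rowF T y) (h2 : colF T x = colF T y) : x = y :=
  T.injective (Subtype.ext (Prod.ext h1 h2))

lemma exists_cell {k : ℕ} {μ : NPartition k} (T : YTableau μ) {r c : ℕ} (h : c < μ.part r) :
    ∃ x, rowF T x = r ∧ colF T x = c :=
  ⟨T.symm ⟨(r, c), h⟩, by simp [rowF], by simp [colF]⟩

lemma colF_lt {k : ℕ} {μ : NPartition k} (T : YTableau μ) (x : Fin k) :
    colF T x < μ.part (rowF T x) := (T x).2

lemma youngSym_eq {k : ℕ} {μ : NPartition k} (T : YTableau μ) :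
    youngSym F T = symS F (rowF T) 1 Finset.univ * symS F (colF T) Equiv.Perm.sign Finset.univ := by
  unfold youngSym symS
  rw [Finset.sum_mul_sum]
  refine Finset.sum_congr ?_ fun σ _ => Finset.sum_congr ?_ fun τ _ => ?_
  · ext σ; rw [Finset.mem_filter, mem_keyGrp]; simp [rowStab, rowF]
  · ext σ; rw [Finset.mem_filter, mem_keyGrp]; simp [colStab, colF]
  · rw [smul_mul_smul_comm, ← sg_mul]
    simp [sg]

lemma youngSym_coeff_one {k : ℕ} {μ : NPartition k} (T : YTableau μ) :
    (youngSym F T).coeff 1 = 1 := by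
  rw [youngSym_eq]
  unfold symS
  rw [Finset.sum_mul_sum, MonoidAlgebra.coeff_sum, Finset.sum_apply', Finset.sum_eq_single 1]
  · rw [MonoidAlgebra.coeff_sum, Finset.sum_apply', Finset.sum_eq_single 1]
    · simp [sg_one, ← sg_mul, sg_coeff]
    · intro τ _ h
      rw [smul_mul_smul_comm, ← sg_mul, MonoidAlgebra.coeff_smul, Finsupp.smul_apply, sg_coeff,
        if_neg (by simpa using h), smul_zero]
    · exact fun h => absurd keyGrp_one h
  · intro σ hσ h
    rw [MonoidAlgebra.coeff_sum, Finset.sum_apply']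
    refine Finset.sum_eq_zero fun τ hτ => ?_
    rw [smul_mul_smul_comm, ← sg_mul, MonoidAlgebra.coeff_smul, Finsupp.smul_apply, sg_coeff,
        if_neg, smul_zero]
    intro h1
    apply h
    have h2 : σ = τ⁻¹ := eq_inv_of_mul_eq_one_left h1
    ext x
    congr 1
    refine rowF_colF_inj T _ _ ((mem_keyGrp.1 hσ).1 x) ?_
    rw [h2]
    exact (mem_keyGrp.1 (keyGrp_inv hτ)).1 x
  · exact fun h => absurd keyGrp_one h

def lexLt {k : ℕ} {μ : NPartition k} (T : YTableau μ) (x y : Fin k) : Prop :=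
  rowF T x < rowF T y ∨ rowF T x = rowF T y ∧ colF T x < colF T y

lemma content_suffix [CharZero F] (t : F) {k : ℕ} {μ : NPartition k} (T : YTableau μ)
    (L : List (Fin k)) (hN : L.Nodup) (hP : L.Pairwise (fun a y => lexLt T y a))
    (hlow : ∀ x ∈ L, ∀ y, lexLt T y x → y ∈ L) :
    (zz F t L * (symS F (rowF T) 1 L.toFinset *
      symS F (colF T) Equiv.Perm.sign L.toFinset)).coeff 1 =
      (L.map fun x => t + (colF T x : F) - (rowF T x : F)).prod := by
  induction L with
  | nil => simp [zz, symS_empty, ← sg_one (F := F) (G := Equiv.Perm (Fin k)), ← sg_mul, sg_coeff]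
  | cons a L ih =>
    have hN' := hN
    rw [List.nodup_cons] at hN'
    rw [List.pairwise_cons] at hP
    have hlow' : ∀ x ∈ L, ∀ y, lexLt T y x → y ∈ L := by
      intro x hx y hy
      have h1 := hlow x (by simp [hx]) y hy
      rw [List.mem_cons] at h1
      rcases h1 with rfl | h1
      · have := hP.1 x hx
        unfold lexLt at hy this; omega
      · exact h1
    have hmem : ∀ y, lexLt T y a → y ∈ L := by
      intro y hy
      have h1 := hlow a (by simp) y hy
      rw [List.mem_cons] at h1
      rcases h1 with rfl | h1
      · unfold lexLt at hy; omega
      · exact h1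
    have hr : (L.toFinset.filter (fun j => rowF T j = rowF T a)).card = colF T a := by
      rw [← Finset.card_range (colF T a)]
      refine Finset.card_bij (fun j _ => colF T j) ?_ ?_ ?_
      · intro j hj
        rw [Finset.mem_filter, List.mem_toFinset] at hj
        have := hP.1 j hj.1
        unfold lexLt at this
        rw [Finset.mem_range]; omega
      · intro j hj j' hj' h
        rw [Finset.mem_filter] at hj hj'
        exact rowF_colF_inj T _ _ (hj.2.trans hj'.2.symm) h
      · intro c hc
        rw [Finset.mem_range] at hc
        obtain ⟨y, hy1, hy2⟩ := exists_cell T (hc.trans (colF_lt T a))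
        refine ⟨y, ?_, hy2⟩
        rw [Finset.mem_filter, List.mem_toFinset]
        exact ⟨hmem y (Or.inr ⟨hy1, by omega⟩), hy1⟩
    have hc : (L.toFinset.filter (fun j => colF T j = colF T a)).card = rowF T a := by
      rw [← Finset.card_range (rowF T a)]
      refine Finset.card_bij (fun j _ => rowF T j) ?_ ?_ ?_
      · intro j hj
        rw [Finset.mem_filter, List.mem_toFinset] at hj
        have := hP.1 j hj.1
        unfold lexLt at this
        rw [Finset.mem_range]; omega
      · intro j hj j' hj' h
        rw [Finset.mem_filter] at hj hj'
        exact rowF_colF_inj T _ _ h (hj.2.trans hj'.2.symm)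
      · intro c hc
        rw [Finset.mem_range] at hc
        obtain ⟨y, hy1, hy2⟩ := exists_cell T ((colF_lt T a).trans_le (μ.antitone hc.le))
        refine ⟨y, ?_, hy1⟩
        rw [Finset.mem_filter, List.mem_toFinset]
        exact ⟨hmem y (Or.inl (by omega)), hy2⟩
    rw [corner_step t (rowF_colF_inj T) hN, hr, hc, ih hN'.2 hP.2 hlow', List.map_cons,
      List.prod_cons]
    intro j hj b hb h1 h2
    have hj' := hP.1 j hj
    have hb' := hP.1 b hb
    have hba : rowF T b < rowF T a := by unfold lexLt at hb'; omega
    have hja : colF T j < colF T a := by unfold lexLt at hj'; omega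
    obtain ⟨q, hq1, hq2⟩ := exists_cell T (r := rowF T b) (c := colF T j)
      (hja.trans (by rw [← h2]; exact colF_lt T b))
    exact ⟨q, hmem q (Or.inl (by omega)), hq1, hq2⟩

lemma exists_sorted {k : ℕ} {μ : NPartition k} (T : YTableau μ) :
    ∃ L : List (Fin k), L.Nodup ∧ (∀ x, x ∈ L) ∧ L.Pairwise (fun a y => lexLt T y a) := by
  have : ∀ D : Finset (Fin k), ∃ L : List (Fin k), L.Nodup ∧ (∀ x, x ∈ L ↔ x ∈ D) ∧
      L.Pairwise (fun a y => lexLt T y a) := by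
    intro D
    induction D using Finset.strongInduction with
    | H D ih =>
      rcases D.eq_empty_or_nonempty with rfl | hne
      · exact ⟨[], by simp, by simp, by simp⟩
      · obtain ⟨a, ha, hmax⟩ := D.exists_max_image (fun x => toLex (rowF T x, colF T x)) hne
        obtain ⟨L, h1, h2, h3⟩ := ih (D.erase a) (Finset.erase_ssubset ha)
        refine ⟨a :: L, ?_, ?_, ?_⟩
        · rw [List.nodup_cons, h2]; exact ⟨by simp, h1⟩
        · intro x
          rw [List.mem_cons, h2, Finset.mem_erase]
          constructor
          · rintro (rfl | h)
            · exact ha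
            · exact h.2
          · intro h
            by_cases hx : x = a
            · exact Or.inl hx
            · exact Or.inr ⟨hx, h⟩
        · rw [List.pairwise_cons]
          refine ⟨fun y hy => ?_, h3⟩
          rw [h2, Finset.mem_erase] at hy
          have h4 := hmax y hy.2
          rw [Prod.Lex.toLex_le_toLex] at h4
          simp only at h4
          have h5 : ¬ (rowF T y = rowF T a ∧ colF T y = colF T a) :=
            fun h => hy.1 (rowF_colF_inj T _ _ h.1 h.2)
          unfold lexLt; omega
  obtain ⟨L, h1, h2, h3⟩ := this Finset.univ
  exact ⟨L, h1, by simpa using h2, h3⟩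

lemma content_formula [CharZero F] (t : F) {k : ℕ} {μ : NPartition k} (T : YTableau μ)
    (L : List (Fin k)) (hN : L.Nodup) (hL : ∀ x, x ∈ L) :
    (zz F t L * youngSym F T).coeff 1 = ∏ x, (t + (colF T x : F) - (rowF T x : F)) := by
  obtain ⟨L', h1, h2, h3⟩ := exists_sorted T
  have hp : L.Perm L' := (List.perm_ext_iff_of_nodup hN h1).2 (by simp [hL, h2])
  have hu : L'.toFinset = Finset.univ := by ext x; simp [h2]
  rw [zz_perm t hp hN, youngSym_eq]
  have := content_suffix t T L' h1 h3 (by simp [h2])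
  rw [hu] at this
  rw [this, ← List.prod_toFinset _ h1, hu]

/-- dominance -/
lemma dom {k : ℕ} (μ ρ : NPartition k) (f : μ.Cell ≃ ρ.Cell)
    (h : ∀ c c', c.1.1 = c'.1.1 → (f c).1.2 = (f c').1.2 → c = c') (j : ℕ) :
    ∑ i ∈ Finset.range j, μ.part i ≤ ∑ i ∈ Finset.range j, ρ.part i := by
  let cell : (Σ i : Fin j, Fin (μ.part i)) → μ.Cell := fun x => ⟨(x.1.1, x.2.1), x.2.2⟩
  have hcell : Function.Injective cell := by
    rintro ⟨⟨i, hi⟩, ⟨c, hc⟩⟩ ⟨⟨i', hi'⟩, ⟨c', hc'⟩⟩ h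
    simp only [cell, Subtype.mk.injEq, Prod.mk.injEq] at h
    obtain ⟨rfl, rfl⟩ := h
    rfl
  have hrow : ∀ x : (Σ i : Fin j, Fin (μ.part i)),
      ¬ (∀ i < j, (f (cell x)).1.2 < ρ.part i) → (f (cell x)).1.1 < j := by
    intro x hx
    push Not at hx
    obtain ⟨i, hi, h1⟩ := hx
    by_contra hn
    have h2 := (f (cell x)).2
    have h3 := ρ.antitone (show i ≤ (f (cell x)).1.1 by omega)
    omega
  let g : (Σ i : Fin j, Fin (μ.part i)) → (Σ i : Fin j, Fin (ρ.part i)) := fun x =>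
    if hx : ∀ i < j, (f (cell x)).1.2 < ρ.part i then
      ⟨x.1, ⟨(f (cell x)).1.2, hx x.1 x.1.2⟩⟩
    else ⟨⟨(f (cell x)).1.1, hrow x hx⟩, ⟨(f (cell x)).1.2, (f (cell x)).2⟩⟩
  have hg1 : ∀ x, ((g x).2 : ℕ) = (f (cell x)).1.2 := by
    intro x
    by_cases hx : ∀ i < j, (f (cell x)).1.2 < ρ.part i
    · have : g x = ⟨x.1, ⟨(f (cell x)).1.2, hx x.1 x.1.2⟩⟩ := dif_pos hx
      rw [this]
    · have : g x = ⟨⟨(f (cell x)).1.1, hrow x hx⟩, ⟨(f (cell x)).1.2, (f (cell x)).2⟩⟩ :=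
        dif_neg hx
      rw [this]
  have hg : Function.Injective g := by
    intro x y hxy
    have hc : (f (cell x)).1.2 = (f (cell y)).1.2 := by rw [← hg1, ← hg1, hxy]
    have h1 : ((g x).1 : ℕ) = (g y).1 := by rw [hxy]
    apply hcell
    by_cases hx : ∀ i < j, (f (cell x)).1.2 < ρ.part i
    · have hy : ∀ i < j, (f (cell y)).1.2 < ρ.part i := by rwa [← hc]
      simp only [g, dif_pos hx, dif_pos hy] at h1
      exact h _ _ h1 hc
    · have hy : ¬ ∀ i < j, (f (cell y)).1.2 < ρ.part i := by rwa [← hc]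
      simp only [g, dif_neg hx, dif_neg hy] at h1
      exact f.injective (Subtype.ext (Prod.ext h1 hc))
  have := Fintype.card_le_of_injective g hg
  simpa [Fintype.card_sigma, Finset.sum_range] using this

lemma npart_ext {k : ℕ} {μ ρ : NPartition k} (h : ∀ i, μ.part i = ρ.part i) : μ = ρ := by
  cases μ; cases ρ
  have := funext h
  simp only at this
  subst this; rfl

lemma dom_antisymm {k : ℕ} {μ ρ : NPartition k}
    (h1 : ∀ j, ∑ i ∈ Finset.range j, μ.part i ≤ ∑ i ∈ Finset.range j, ρ.part i)
    (h2 : ∀ j, ∑ i ∈ Finset.range j, ρ.part i ≤ ∑ i ∈ Finset.range j, μ.part i) : μ = ρ := by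
  apply npart_ext
  intro i
  have e1 := le_antisymm (h1 i) (h2 i)
  have e2 := le_antisymm (h1 (i + 1)) (h2 (i + 1))
  rw [Finset.sum_range_succ, Finset.sum_range_succ] at e2
  omega

lemma young_orth [CharZero F] {k : ℕ} {μ ρ : NPartition k} (hne : μ ≠ ρ) (T : YTableau μ)
    (T' : YTableau ρ) (g : Equiv.Perm (Fin k)) :
    youngSym F T * sg F g * youngSym F T' = 0 := by
  rw [youngSym_eq, youngSym_eq]
  set R := symS F (rowF T) 1 Finset.univ
  set C := symS F (colF T) Equiv.Perm.sign Finset.univ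
  set R' := symS F (rowF T') 1 Finset.univ
  set C' := symS F (colF T') Equiv.Perm.sign Finset.univ
  have hre : R * C * sg F g * (R' * C') = R * (C * sg F g * R') * C' := by simp only [mul_assoc]
  rw [hre]
  by_cases hA : ∃ p q, p ≠ q ∧ colF T (g p) = colF T (g q) ∧ rowF T' p = rowF T' q
  · obtain ⟨p, q, hpq, h1, h2⟩ := hA
    have : C * sg F g * R' = 0 := by
      refine sandwich_zero (p := p) (q := q) _ (Finset.mem_univ _) (Finset.mem_univ _)
        (Finset.mem_univ _) (Finset.mem_univ _) h1 h2 ?_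
      rw [Equiv.Perm.sign_swap (g.injective.ne hpq)]; simp
    rw [this]; simp
  push Not at hA
  have d1 : ∀ j, ∑ i ∈ Finset.range j, ρ.part i ≤ ∑ i ∈ Finset.range j, μ.part i := by
    refine dom ρ μ ((T'.symm.trans g).trans T) ?_
    intro c c' h1 h2
    by_contra hcc
    refine hA (T'.symm c) (T'.symm c') (T'.symm.injective.ne hcc) h2 ?_
    simpa [rowF] using h1
  rw [sg_expand (C * sg F g * R'), Finset.mul_sum, Finset.sum_mul]
  refine Finset.sum_eq_zero fun h _ => ?_
  rw [mul_smul_comm, smul_mul_assoc]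
  by_cases hB : ∃ p q, p ≠ q ∧ rowF T (h p) = rowF T (h q) ∧ colF T' p = colF T' q
  · obtain ⟨p, q, hpq, h1, h2⟩ := hB
    have : R * sg F h * C' = 0 := by
      refine sandwich_zero (p := p) (q := q) _ (Finset.mem_univ _) (Finset.mem_univ _)
        (Finset.mem_univ _) (Finset.mem_univ _) h1 h2 ?_
      rw [Equiv.Perm.sign_swap hpq]; simp
    rw [this]; simp
  push Not at hB
  exfalso
  apply hne
  refine dom_antisymm ?_ d1
  refine dom μ ρ ((T.symm.trans h.symm).trans T') ?_
  intro c c' h1 h2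
  by_contra hcc
  refine hB (h.symm (T.symm c)) (h.symm (T.symm c'))
    (h.symm.injective.ne (T.symm.injective.ne hcc)) ?_ h2
  simpa [rowF] using h1

end Young


/-! ### The center of the group algebra -/
section Center
variable {F : Type*} [Field F]

variable (F) in
def cen (k : ℕ) : Submodule F (GA F (Equiv.Perm (Fin k))) where
  carrier := {x | ∀ h, sg F h * x = x * sg F h}
  add_mem' := by intro a b ha hb h; rw [mul_add, add_mul, ha h, hb h]
  zero_mem' := by intro h; simp
  smul_mem' := by intro c x hx h; rw [mul_smul_comm, smul_mul_assoc, hx h]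

lemma mem_cen {k : ℕ} {x : GA F (Equiv.Perm (Fin k))} :
    x ∈ cen F k ↔ ∀ h, sg F h * x = x * sg F h := Iff.rfl

lemma cen_comm {k : ℕ} {x : GA F (Equiv.Perm (Fin k))} (hx : x ∈ cen F k)
    (y : GA F (Equiv.Perm (Fin k))) : y * x = x * y := by
  rw [sg_expand y, Finset.sum_mul, Finset.mul_sum]
  refine Finset.sum_congr rfl fun g _ => ?_
  rw [smul_mul_assoc, mul_smul_comm, mem_cen.1 hx]

lemma cen_conj {k : ℕ} {x : GA F (Equiv.Perm (Fin k))} (hx : x ∈ cen F k)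
    {g h : Equiv.Perm (Fin k)} (hc : IsConj g h) : x.coeff g = x.coeff h := by
  obtain ⟨c, rfl⟩ := isConj_iff.1 hc
  have h1 := congrArg (fun y => y.coeff (c * g)) (mem_cen.1 hx c)
  simp only [coeff_sg_mul, coeff_mul_sg] at h1
  simpa using h1

lemma cen_of_conj {k : ℕ} {x : GA F (Equiv.Perm (Fin k))}
    (hx : ∀ c g : Equiv.Perm (Fin k), x.coeff (c * g * c⁻¹) = x.coeff g) : x ∈ cen F k := by
  rw [mem_cen]
  intro h
  ext g
  rw [coeff_sg_mul, coeff_mul_sg, ← hx h (h⁻¹ * g)]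
  congr 1; group

lemma isConj_inv' {k : ℕ} (g : Equiv.Perm (Fin k)) : IsConj g g⁻¹ := by
  rw [Equiv.Perm.isConj_iff_cycleType_eq, Equiv.Perm.cycleType_inv]

lemma coeff_one_mul {k : ℕ} (x y : GA F (Equiv.Perm (Fin k))) :
    (x * y).coeff 1 = ∑ g, x.coeff g * y.coeff g⁻¹ := by
  conv_lhs => rw [sg_expand x]
  rw [Finset.sum_mul, MonoidAlgebra.coeff_sum, Finset.sum_apply']
  refine Finset.sum_congr rfl fun g _ => ?_
  rw [smul_mul_assoc, MonoidAlgebra.coeff_smul, Finsupp.smul_apply, coeff_sg_mul, mul_one,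
    smul_eq_mul]

variable (F) in
def zeta {k : ℕ} {μ : NPartition k} (T : YTableau μ) : GA F (Equiv.Perm (Fin k)) :=
  ∑ g, sg F g * youngSym F T * sg F g⁻¹

lemma zeta_mem {k : ℕ} {μ : NPartition k} (T : YTableau μ) : zeta F T ∈ cen F k := by
  rw [mem_cen]
  intro h
  unfold zeta
  rw [Finset.mul_sum, Finset.sum_mul]
  refine Fintype.sum_equiv (Equiv.mulLeft h) _ _ fun g => ?_
  simp only [Equiv.coe_mulLeft, mul_inv_rev, sg_mul, mul_assoc]
  rw [← sg_mul h⁻¹ h]; simp [sg_one]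

lemma zeta_coeff_one {k : ℕ} {μ : NPartition k} (T : YTableau μ) :
    (zeta F T).coeff 1 = (Fintype.card (Equiv.Perm (Fin k)) : F) := by
  unfold zeta
  rw [MonoidAlgebra.coeff_sum, Finset.sum_apply']
  rw [Finset.sum_congr rfl (g := fun _ => (1 : F))]
  · simp
  · intro g _
    rw [coeff_mul_sg, coeff_sg_mul]
    simp [youngSym_coeff_one]

lemma youngSym_int {k : ℕ} {μ : NPartition k} (T : YTableau μ) (h : Equiv.Perm (Fin k)) :
    (youngSym F T).coeff h ∈ (Int.castRingHom F).range := by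
  unfold youngSym
  rw [MonoidAlgebra.coeff_sum, Finset.sum_apply']
  refine sum_mem fun σ _ => ?_
  rw [MonoidAlgebra.coeff_sum, Finset.sum_apply']
  refine sum_mem fun τ _ => ?_
  rw [MonoidAlgebra.coeff_smul, Finsupp.smul_apply]
  refine zsmul_mem ?_ _
  have := sg_coeff (F := F) (σ * τ) h
  unfold sg at this
  rw [this]
  split_ifs
  · exact one_mem _
  · exact zero_mem _

lemma zeta_int {k : ℕ} {μ : NPartition k} (T : YTableau μ) (h : Equiv.Perm (Fin k)) :
    ∃ z : ℤ, (zeta F T).coeff h = z := by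
  have : (zeta F T).coeff h ∈ (Int.castRingHom F).range := by
    unfold zeta
    rw [MonoidAlgebra.coeff_sum, Finset.sum_apply']
    refine sum_mem fun σ _ => ?_
    rw [coeff_mul_sg, coeff_sg_mul]
    exact youngSym_int T _
  obtain ⟨z, hz⟩ := this
  exact ⟨z, hz.symm⟩

lemma zeta_sq [CharZero F] {k : ℕ} {μ : NPartition k} (T : YTableau μ) :
    (zeta F T * zeta F T).coeff 1 ≠ 0 := by
  choose z hz using zeta_int (F := F) T
  have h1 : (zeta F T * zeta F T).coeff 1 = ((∑ g, z g ^ 2 : ℤ) : F) := by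
    rw [coeff_one_mul]
    push_cast
    refine Finset.sum_congr rfl fun g _ => ?_
    rw [← cen_conj (zeta_mem T) (isConj_inv' g), hz]; ring
  rw [h1, Int.cast_ne_zero]
  refine (Finset.sum_pos' (fun g _ => sq_nonneg _) ⟨1, Finset.mem_univ _, ?_⟩).ne'
  have h2 : (z 1 : F) ≠ 0 := by
    rw [← hz, zeta_coeff_one]
    exact_mod_cast Fintype.card_ne_zero
  have h3 : z 1 ≠ 0 := by exact_mod_cast h2
  positivity

lemma young_orth' [CharZero F] {k : ℕ} {μ ρ : NPartition k} (hne : μ ≠ ρ) (T : YTableau μ)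
    (T' : YTableau ρ) (x : GA F (Equiv.Perm (Fin k))) :
    youngSym F T * x * youngSym F T' = 0 := by
  rw [sg_expand x, Finset.mul_sum, Finset.sum_mul]
  refine Finset.sum_eq_zero fun g _ => ?_
  rw [mul_smul_comm, smul_mul_assoc, young_orth hne, smul_zero]

lemma zeta_young [CharZero F] {k : ℕ} {μ ρ : NPartition k} (hne : μ ≠ ρ) (T : YTableau μ)
    (T' : YTableau ρ) (x : GA F (Equiv.Perm (Fin k))) :
    zeta F T * (x * youngSym F T') = 0 := by
  unfold zeta
  rw [Finset.sum_mul]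
  refine Finset.sum_eq_zero fun g _ => ?_
  have := young_orth' (F := F) hne T T' (sg F g⁻¹ * x)
  simp only [mul_assoc] at this ⊢
  rw [this, mul_zero]

lemma zeta_orth [CharZero F] {k : ℕ} {μ ρ : NPartition k} (hne : μ ≠ ρ) (T : YTableau μ)
    (T' : YTableau ρ) : zeta F T * zeta F T' = 0 := by
  conv_lhs => rw [zeta.eq_def F T']
  rw [Finset.mul_sum]
  refine Finset.sum_eq_zero fun g _ => ?_
  rw [← mul_assoc, zeta_young hne, zero_mul]

instance {k : ℕ} : Finite (NPartition k) := by
  have hle : ∀ (μ : NPartition k) (i : Fin k), μ.part i < k + 1 := by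
    intro μ i
    have := Finset.single_le_sum (f := μ.part) (fun _ _ => Nat.zero_le _)
      (Finset.mem_range.2 i.2)
    rw [μ.sum_eq] at this
    omega
  refine Finite.of_injective (β := Fin k → Fin (k + 1)) (fun μ i => ⟨μ.part i, hle μ i⟩) ?_
  intro μ ρ h
  apply npart_ext
  intro i
  by_cases hi : i < k
  · have := congrFun h ⟨i, hi⟩
    simpa using this
  · rw [μ.part_eq_zero i (by omega), ρ.part_eq_zero i (by omega)]

instance {k : ℕ} : Fintype (NPartition k) := Fintype.ofFinite _

lemma cell_finite {k : ℕ} (μ : NPartition k) : Nonempty (YTableau μ) := by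
  let e : μ.Cell ≃ (Σ i : Fin k, Fin (μ.part i)) :=
    { toFun := fun c => ⟨⟨c.1.1, by
        by_contra h
        have := c.2
        rw [μ.part_eq_zero _ (by omega)] at this; omega⟩, ⟨c.1.2, c.2⟩⟩
      invFun := fun x => ⟨(x.1.1, x.2.1), x.2.2⟩
      left_inv := fun c => rfl
      right_inv := fun c => rfl }
  refine ⟨(Fintype.equivOfCardEq ?_).trans e.symm⟩
  rw [Fintype.card_sigma]
  simp only [Fintype.card_fin]
  rw [← Finset.sum_range, μ.sum_eq]

lemma getD_sum (l : List ℕ) (k : ℕ) (h : l.length ≤ k) :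
    ∑ i ∈ Finset.range k, l.getD i 0 = l.sum := by
  induction l generalizing k with
  | nil => simp
  | cons a l ih =>
    obtain ⟨k, rfl⟩ : ∃ k', k = k' + 1 := ⟨k - 1, by simp at h; omega⟩
    rw [Finset.sum_range_succ']
    simp only [List.getD_cons_succ, List.getD_cons_zero, List.sum_cons]
    rw [ih k (by simpa using h), add_comm]

lemma length_le_sum (l : List ℕ) (h : ∀ x ∈ l, 0 < x) : l.length ≤ l.sum := by
  induction l with
  | nil => simp
  | cons a l ih =>
    have := ih fun x hx => h x (by simp [hx])
    have := h a (by simp)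
    simp; omega

def toNP {k : ℕ} (p : Nat.Partition k) : NPartition k where
  part := fun i => (p.parts.sort (· ≥ ·)).getD i 0
  antitone := by
    intro i j hij
    by_cases hj : j < (p.parts.sort (· ≥ ·)).length
    · simp only [List.getD_eq_getElem _ _ hj, List.getD_eq_getElem _ _ (hij.trans_lt hj)]
      rcases hij.eq_or_lt with rfl | h
      · exact le_rfl
      · exact List.pairwise_iff_getElem.1 (Multiset.pairwise_sort p.parts (· ≥ ·)) i j
          (hij.trans_lt hj) hj h
    · exact (List.getD_eq_default _ _ (not_lt.1 hj)).trans_le (Nat.zero_le _)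
  part_eq_zero := by
    intro i hi
    apply List.getD_eq_default
    refine le_trans (length_le_sum _ ?_) (le_trans (le_of_eq ?_) hi)
    · intro x hx; exact p.parts_pos ((Multiset.mem_sort (· ≥ ·)).1 hx)
    · rw [← Multiset.sum_coe, Multiset.sort_eq, p.parts_sum]
  sum_eq := by
    have h : (p.parts.sort (· ≥ ·)).sum = k := by
      rw [← Multiset.sum_coe, Multiset.sort_eq, p.parts_sum]
    rw [getD_sum, h]
    refine le_trans (length_le_sum _ ?_) h.le
    intro x hx; exact p.parts_pos ((Multiset.mem_sort (· ≥ ·)).1 hx)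

lemma toNP_inj {k : ℕ} : Function.Injective (toNP (k := k)) := by
  intro p q h
  have h1 : ∀ i, (p.parts.sort (· ≥ ·)).getD i 0 = (q.parts.sort (· ≥ ·)).getD i 0 :=
    fun i => congrFun (congrArg NPartition.part h) i
  have hpos : ∀ (p : Nat.Partition k) (i : ℕ),
      i < (p.parts.sort (· ≥ ·)).length ↔ 0 < (p.parts.sort (· ≥ ·)).getD i 0 := by
    intro p i
    constructor
    · intro hi
      rw [List.getD_eq_getElem _ _ hi]
      exact p.parts_pos ((Multiset.mem_sort (· ≥ ·)).1 (List.getElem_mem hi))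
    · intro hi
      by_contra hn
      rw [List.getD_eq_default _ _ (not_lt.1 hn)] at hi
      exact lt_irrefl _ hi
  have hlen : (p.parts.sort (· ≥ ·)).length = (q.parts.sort (· ≥ ·)).length := by
    refine eq_of_forall_lt_iff fun i => ?_
    rw [hpos, hpos, h1]
  have h2 : p.parts.sort (· ≥ ·) = q.parts.sort (· ≥ ·) := by
    refine List.ext_getElem hlen fun i hi hi' => ?_
    have := h1 i
    rwa [List.getD_eq_getElem _ _ hi, List.getD_eq_getElem _ _ hi'] at this
  apply Nat.Partition.ext
  rw [← Multiset.sort_eq p.parts (· ≥ ·), h2, Multiset.sort_eq]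

lemma finrank_cen (k : ℕ) : Module.finrank F (cen F k) ≤ Fintype.card (NPartition k) := by
  have hk : Fintype.card (Fin k) = k := Fintype.card_fin k
  have h1 : Fintype.card (Nat.Partition (Fintype.card (Fin k))) ≤ Fintype.card (NPartition k) := by
    rw [hk]
    exact Fintype.card_le_of_injective _ toNP_inj
  refine le_trans ?_ h1
  let rep : Nat.Partition (Fintype.card (Fin k)) → Equiv.Perm (Fin k) := fun p =>
    if h : ∃ σ : Equiv.Perm (Fin k), σ.partition = p then h.choose else 1
  have hrep : ∀ σ : Equiv.Perm (Fin k), IsConj (rep σ.partition) σ := by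
    intro σ
    have h : ∃ σ' : Equiv.Perm (Fin k), σ'.partition = σ.partition := ⟨σ, rfl⟩
    have : rep σ.partition = h.choose := dif_pos h
    rw [this, Equiv.Perm.partition_eq_of_isConj]
    exact h.choose_spec
  let Φ : cen F k →ₗ[F] (Nat.Partition (Fintype.card (Fin k)) → F) :=
    { toFun := fun x p => x.1.coeff (rep p)
      map_add' := fun x y => by ext p; simp
      map_smul' := fun c x => by ext p; simp }
  have hΦ : Function.Injective Φ := by
    intro x y h
    apply Subtype.ext
    ext σ
    have := congrFun h σ.partition
    rw [← cen_conj x.2 (hrep σ), ← cen_conj y.2 (hrep σ)]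
    exact this
  have := LinearMap.finrank_le_finrank_of_injective hΦ
  simpa using this

lemma cen_span [CharZero F] {k : ℕ} (Tf : ∀ μ : NPartition k, YTableau μ)
    {x : GA F (Equiv.Perm (Fin k))} (hx : x ∈ cen F k) :
    ∃ a : NPartition k → F, x = ∑ μ, a μ • zeta F (Tf μ) := by
  let v : NPartition k → cen F k := fun μ => ⟨zeta F (Tf μ), zeta_mem _⟩
  have hv : LinearIndependent F v := by
    rw [Fintype.linearIndependent_iff]
    intro g hg μ
    have h1 : ∑ ρ, g ρ • zeta F (Tf ρ) = 0 := by
      have := congrArg Subtype.val hg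
      simpa [v] using this
    have h2 := congrArg (fun y => (y * zeta F (Tf μ)).coeff 1) h1
    simp only [Finset.sum_mul, zero_mul] at h2
    rw [Finset.sum_eq_single μ] at h2
    · rw [smul_mul_assoc, MonoidAlgebra.coeff_smul, Finsupp.smul_apply, smul_eq_mul] at h2
      exact (mul_eq_zero.1 (by simpa using h2)).resolve_right (zeta_sq _)
    · intro ρ _ h
      rw [smul_mul_assoc, zeta_orth h, smul_zero]
    · simp
  have hc : Fintype.card (NPartition k) = Module.finrank F (cen F k) :=
    le_antisymm hv.fintype_card_le_finrank (finrank_cen k)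
  have ht := hv.span_eq_top_of_card_eq_finrank' hc
  have : (⟨x, hx⟩ : cen F k) ∈ Submodule.span F (Set.range v) := by rw [ht]; trivial
  rw [Submodule.mem_span_range_iff_exists_fun] at this
  obtain ⟨a, ha⟩ := this
  refine ⟨a, ?_⟩
  have := congrArg Subtype.val ha
  simpa [v] using this.symm

lemma exists_Tf {k : ℕ} {μ : NPartition k} (T : YTableau μ) :
    ∃ Tf : ∀ μ : NPartition k, YTableau μ, Tf μ = T := by
  exact ⟨Function.update (fun μ => (cell_finite μ).some) μ T, by simp⟩

lemma cen_young [CharZero F] {k : ℕ} {μ : NPartition k} (T : YTableau μ)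
    {x : GA F (Equiv.Perm (Fin k))} (hx : x ∈ cen F k) :
    ∃ c : F, x * youngSym F T = c • (zeta F T * youngSym F T) := by
  obtain ⟨Tf, hTf⟩ := exists_Tf T
  obtain ⟨a, rfl⟩ := cen_span Tf hx
  refine ⟨a μ, ?_⟩
  rw [Finset.sum_mul, Finset.sum_eq_single μ]
  · rw [smul_mul_assoc, hTf]
  · intro ρ _ h
    have := zeta_young (F := F) h (Tf ρ) T 1
    rw [one_mul] at this
    rw [smul_mul_assoc, this, smul_zero]
  · simp

lemma young_ne_zero {k : ℕ} {μ : NPartition k} (T : YTableau μ) : youngSym F T ≠ 0 := by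
  intro h
  have := youngSym_coeff_one (F := F) T
  rw [h] at this
  simp at this

lemma young_zeta [CharZero F] {k : ℕ} {μ : NPartition k} (T : YTableau μ) :
    ∃ c : F, youngSym F T = c • (zeta F T * youngSym F T) := by
  have h : (1 : GA F (Equiv.Perm (Fin k))) ∈ cen F k := by rw [mem_cen]; simp
  obtain ⟨c, hc⟩ := cen_young T h
  exact ⟨c, by rw [← hc, one_mul]⟩

lemma cen_mul_young [CharZero F] {k : ℕ} {μ : NPartition k} (T : YTableau μ)
    {x : GA F (Equiv.Perm (Fin k))} (hx : x ∈ cen F k) :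
    x * youngSym F T = (x * youngSym F T).coeff 1 • youngSym F T := by
  obtain ⟨c, hc⟩ := young_zeta (F := F) T
  obtain ⟨c', hc'⟩ := cen_young T hx
  have hc0 : c ≠ 0 := by
    rintro rfl
    exact young_ne_zero (F := F) T (by rw [hc, zero_smul])
  have h1 : x * youngSym F T = (c' / c) • youngSym F T := by
    rw [hc']
    conv_rhs => rw [hc]
    rw [smul_smul, div_mul_cancel₀ _ hc0]
  rw [h1, MonoidAlgebra.coeff_smul, Finsupp.smul_apply, youngSym_coeff_one, smul_eq_mul, mul_one]

lemma cen_mul_zeta [CharZero F] {k : ℕ} {μ : NPartition k} (T : YTableau μ)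
    {x : GA F (Equiv.Perm (Fin k))} (hx : x ∈ cen F k) :
    x * zeta F T = (x * youngSym F T).coeff 1 • zeta F T := by
  unfold zeta
  rw [Finset.mul_sum, Finset.smul_sum]
  refine Finset.sum_congr rfl fun g _ => ?_
  rw [← mul_assoc, ← mul_assoc, ← cen_comm hx, mul_assoc (sg F g), cen_mul_young T hx,
    mul_smul_comm, smul_mul_assoc]
  congr 1
  rw [MonoidAlgebra.coeff_smul, Finsupp.smul_apply, youngSym_coeff_one, smul_eq_mul, mul_one]

lemma zz_cen (t : F) {k : ℕ} {L : List (Fin k)} (hN : L.Nodup) (hL : ∀ x, x ∈ L) :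
    zz F t L ∈ cen F k := by
  rw [mem_cen]
  intro h
  exact zz_commute t hN (fun x hx => absurd (hL x) hx)

end Center


/-! ### The character element -/
section Chi
variable {F : Type*} [Field F]

variable (F) in
def idl {k : ℕ} (e : GA F (Equiv.Perm (Fin k))) : Submodule F (GA F (Equiv.Perm (Fin k))) :=
  (Submodule.span (MonoidAlgebra F (Equiv.Perm (Fin k))) {e}).restrictScalars F

lemma mem_idl {k : ℕ} {e x : GA F (Equiv.Perm (Fin k))} : x ∈ idl F e ↔ ∃ y, y * e = x := by
  unfold idl
  rw [Submodule.restrictScalars_mem, Submodule.mem_span_singleton]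
  rfl

def lact {k : ℕ} (e : GA F (Equiv.Perm (Fin k))) :
    GA F (Equiv.Perm (Fin k)) →ₗ[F] Module.End F (idl F e) where
  toFun x := (LinearMap.mulLeft F x).restrict (p := idl F e) (q := idl F e) (fun y hy => by
    rw [mem_idl] at hy ⊢
    obtain ⟨z, rfl⟩ := hy
    exact ⟨x * z, by simp [mul_assoc]⟩)
  map_add' x y := by ext z; simp [add_mul]
  map_smul' c x := by ext z; simp

lemma lact_apply {k : ℕ} (e x : GA F (Equiv.Perm (Fin k))) (y : idl F e) :
    ((lact e x y : idl F e) : GA F (Equiv.Perm (Fin k))) = x * y := rfl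

lemma lact_mul {k : ℕ} (e x y : GA F (Equiv.Perm (Fin k))) :
    lact e (x * y) = lact e x * lact e y := by
  ext z
  simp [lact_apply, mul_assoc]

lemma lact_one {k : ℕ} (e : GA F (Equiv.Perm (Fin k))) : lact e 1 = 1 := by
  ext z
  simp [lact_apply]

lemma idealChar_eq {k : ℕ} (e : GA F (Equiv.Perm (Fin k))) (σ : Equiv.Perm (Fin k)) :
    idealChar F e σ = LinearMap.trace F _ (lact e (sg F σ)) := rfl

lemma idealChar_conj {k : ℕ} (e : GA F (Equiv.Perm (Fin k))) (c g : Equiv.Perm (Fin k)) :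
    idealChar F e (c * g * c⁻¹) = idealChar F e g := by
  rw [idealChar_eq, idealChar_eq, sg_mul, lact_mul, LinearMap.trace_mul_comm, ← lact_mul, ← sg_mul]
  congr 3; group

variable (F) in
def zchi {k : ℕ} {μ : NPartition k} (T : YTableau μ) : GA F (Equiv.Perm (Fin k)) :=
  ∑ σ, idealChar F (youngSym F T) σ • sg F σ

lemma zchi_coeff {k : ℕ} {μ : NPartition k} (T : YTableau μ) (g : Equiv.Perm (Fin k)) :
    (zchi F T).coeff g = idealChar F (youngSym F T) g := by
  unfold zchi
  rw [MonoidAlgebra.coeff_sum, Finset.sum_apply']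
  simp [sg_coeff]

lemma zchi_mem {k : ℕ} {μ : NPartition k} (T : YTableau μ) : zchi F T ∈ cen F k := by
  apply cen_of_conj
  intro c g
  rw [zchi_coeff, zchi_coeff, idealChar_conj]

lemma zchi_tr {k : ℕ} {μ : NPartition k} (T : YTableau μ) {y : GA F (Equiv.Perm (Fin k))}
    (hy : y ∈ cen F k) :
    (zchi F T * y).coeff 1 = LinearMap.trace F _ (lact (youngSym F T) y) := by
  rw [coeff_one_mul]
  conv_rhs => rw [sg_expand y]
  rw [map_sum, map_sum]
  refine Finset.sum_congr rfl fun g _ => ?_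
  rw [map_smul, map_smul, ← idealChar_eq, zchi_coeff, ← cen_conj hy (isConj_inv' g), mul_comm,
    smul_eq_mul]

lemma zchi_eq [CharZero F] {k : ℕ} {μ : NPartition k} (T : YTableau μ) :
    ∃ c : F, c ≠ 0 ∧ zchi F T = c • zeta F T := by
  obtain ⟨Tf, hTf⟩ := exists_Tf T
  obtain ⟨a, ha⟩ := cen_span Tf (zchi_mem (F := F) T)
  have h0 : ∀ ρ, ρ ≠ μ → a ρ = 0 := by
    intro ρ hρ
    have h1 := zchi_tr T (zeta_mem (F := F) (Tf ρ))
    have h2 : lact (youngSym F T) (zeta F (Tf ρ)) = 0 := by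
      ext z
      obtain ⟨z, hz⟩ := z
      obtain ⟨y, rfl⟩ := mem_idl.1 hz
      rw [lact_apply]
      simp [zeta_young hρ]
    rw [h2, map_zero, ha, Finset.sum_mul, Finset.sum_eq_single ρ] at h1
    · rw [smul_mul_assoc, MonoidAlgebra.coeff_smul, Finsupp.smul_apply, smul_eq_mul] at h1
      exact (mul_eq_zero.1 h1).resolve_right (zeta_sq _)
    · intro ρ' _ h
      rw [smul_mul_assoc, zeta_orth h, smul_zero]
    · simp
  have h3 : zchi F T = a μ • zeta F T := by
    conv_lhs => rw [ha]
    rw [Finset.sum_eq_single μ, hTf]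
    · intro ρ _ h
      rw [h0 ρ h, zero_smul]
    · simp
  refine ⟨a μ, ?_, h3⟩
  intro h4
  rw [h4, zero_smul] at h3
  have h5 := zchi_tr (F := F) T (y := 1) (by rw [mem_cen]; simp)
  rw [h3, zero_mul, lact_one, LinearMap.trace_one] at h5
  have h6 : Module.finrank F (idl F (youngSym F T)) = 0 := by
    have : ((Module.finrank F (idl F (youngSym F T)) : ℕ) : F) = 0 := by rw [← h5]; simp
    exact_mod_cast this
  have h7 : (⟨youngSym F T, mem_idl.2 ⟨1, by simp⟩⟩ : idl F (youngSym F T)) = 0 := by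
    have := Module.finrank_zero_iff.1 h6
    exact Subsingleton.elim _ _
  exact young_ne_zero (F := F) T (congrArg Subtype.val h7)

lemma young_zchi [CharZero F] {k : ℕ} {μ : NPartition k} (T : YTableau μ) :
    ∃ c : F, youngSym F T = c • (zchi F T * youngSym F T) := by
  obtain ⟨c, hc⟩ := young_zeta (F := F) T
  obtain ⟨c', h0, hc'⟩ := zchi_eq (F := F) T
  refine ⟨c / c', ?_⟩
  rw [hc', smul_mul_assoc, smul_smul, div_mul_cancel₀ _ h0, ← hc]

/-! two-sided span -/
variable (F) in
def tspan {G : Type*} [Group G] (S : Set (GA F G)) : Submodule F (GA F G) :=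
  Submodule.span F {w | ∃ u ∈ S, ∃ x y : G, w = sg F x * u * sg F y}

lemma tspan_mem {G : Type*} [Group G] [Fintype G] {S : Set (GA F G)} {u : GA F G} (hu : u ∈ S)
    (x y : GA F G) : x * u * y ∈ tspan F S := by
  rw [sg_expand x, sg_expand y, Finset.sum_mul, Finset.sum_mul]
  refine sum_mem fun g _ => ?_
  rw [Finset.mul_sum]
  refine sum_mem fun h _ => ?_
  rw [mul_smul_comm, smul_mul_assoc, smul_mul_assoc]
  exact Submodule.smul_mem _ _ (Submodule.smul_mem _ _ (Submodule.subset_span ⟨u, hu, g, h, rfl⟩))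

lemma zeta_tspan {k : ℕ} {μ : NPartition k} (T : YTableau μ) {S} (hS : youngSym F T ∈ S)
    (x : GA F (Equiv.Perm (Fin k))) : zeta F T * x ∈ tspan F S := by
  unfold zeta
  rw [Finset.sum_mul]
  refine sum_mem fun g _ => ?_
  rw [mul_assoc]
  exact tspan_mem hS _ _

end Chi


/-! ### Branching -/
section Branch
variable {F : Type*} [Field F]
open Polynomial in
lemma count_le_of_poly [CharZero F] {α β : Type*} [Fintype α] [Fintype β] (s : α → F) (s' : β → F)
    (p : F[X]) (m : F) (hm : m ≠ 0)
    (h : ∀ t, (∏ x, (t - s x)) * m = (∏ x, (t - s' x)) * p.eval t) (r : F) :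
    (Finset.univ.filter fun x => s' x = r).card ≤ (Finset.univ.filter fun x => s x = r).card := by
  have h1 : (∏ x, (X - C (s x))) * C m = (∏ x, (X - C (s' x))) * p := by
    apply Polynomial.funext
    intro t
    rw [eval_mul, eval_mul, eval_prod, eval_prod]
    simpa using h t
  have e1 : ∀ {γ : Type _} [Fintype γ] (u : γ → F), (∏ x, (X - C (u x))).roots =
      (Finset.univ.val.map u) := by
    intro γ _ u
    rw [← roots_multiset_prod_X_sub_C (Multiset.map u Finset.univ.val), Multiset.map_map]
    rfl
  have e1' : ∀ {γ : Type _} [Fintype γ] (u : γ → F), (∏ x, (X - C (u x))).roots =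
      (Finset.univ.val.map u) := by
    intro γ _ u
    rw [← roots_multiset_prod_X_sub_C (Multiset.map u Finset.univ.val), Multiset.map_map]
    rfl
  have h2 : (∏ x, (X - C (s' x))).roots ≤ ((∏ x, (X - C (s x))) * C m).roots := by
    refine roots.le_of_dvd ?_ ⟨p, h1⟩
    refine mul_ne_zero ?_ (by simpa using hm)
    exact Finset.prod_ne_zero_iff.2 fun x _ => X_sub_C_ne_zero _
  rw [mul_comm, roots_C_mul _ hm, e1, e1'] at h2
  have h3 := Multiset.count_le_of_le r h2
  rw [Multiset.count_map, Multiset.count_map] at h3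
  simpa [Finset.card, Finset.filter, eq_comm] using h3

variable (F) in
def iot {k n : ℕ} (ι : Fin k ↪ Fin n) :
    GA F (Equiv.Perm (Fin k)) →ₐ[F] GA F (Equiv.Perm (Fin n)) :=
  MonoidAlgebra.mapDomainAlgHom F F (Equiv.Perm.viaEmbeddingHom ι)

lemma iot_sg {k n : ℕ} (ι : Fin k ↪ Fin n) (σ : Equiv.Perm (Fin k)) :
    iot F ι (sg F σ) = sg F (σ.viaEmbedding ι) := by
  simp [iot, sg, MonoidAlgebra.mapDomainAlgHom]
  rfl

lemma via_swap {k n : ℕ} (ι : Fin k ↪ Fin n) (a b : Fin k) :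
    (Equiv.swap a b).viaEmbedding ι = Equiv.swap (ι a) (ι b) := by
  ext x
  congr 1
  by_cases hx : x ∈ Set.range ι
  · obtain ⟨y, rfl⟩ := hx
    rw [Equiv.Perm.viaEmbedding_apply, ι.injective.map_swap]
  · rw [Equiv.Perm.viaEmbedding_apply_of_notMem _ _ _ hx, Equiv.swap_apply_of_ne_of_ne]
    · rintro rfl; exact hx ⟨a, rfl⟩
    · rintro rfl; exact hx ⟨b, rfl⟩

lemma via_sign {k n : ℕ} (ι : Fin k ↪ Fin n) (σ : Equiv.Perm (Fin k)) :
    Equiv.Perm.sign (σ.viaEmbedding ι) = Equiv.Perm.sign σ := by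
  unfold Equiv.Perm.viaEmbedding
  convert Equiv.Perm.sign_extendDomain σ _

lemma via_key {k n : ℕ} (ι : Fin k ↪ Fin n) {κ : Fin k → ℕ} {κ' : Fin n → ℕ}
    (h : ∀ x, κ' (ι x) = κ x) {σ : Equiv.Perm (Fin k)} (hσ : σ ∈ keyGrp κ Finset.univ) :
    σ.viaEmbedding ι ∈ keyGrp κ' Finset.univ := by
  rw [mem_keyGrp] at *
  refine ⟨fun x => ?_, by simp⟩
  by_cases hx : x ∈ Set.range ι
  · obtain ⟨y, rfl⟩ := hx
    rw [Equiv.Perm.viaEmbedding_apply, h, h, hσ.1]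
  · rw [Equiv.Perm.viaEmbedding_apply_of_notMem _ _ _ hx]

lemma card_key_ne [CharZero F] {k : ℕ} (κ : Fin k → ℕ) :
    ((keyGrp κ Finset.univ).card : F) ≠ 0 := by
  rw [Nat.cast_ne_zero, Finset.card_ne_zero]
  exact ⟨1, keyGrp_one⟩

lemma symS_iot {k n : ℕ} (ι : Fin k ↪ Fin n) {κ : Fin k → ℕ} {κ' : Fin n → ℕ}
    (h : ∀ x, κ' (ι x) = κ x) (ε : Equiv.Perm (Fin k) →* ℤˣ) (ε' : Equiv.Perm (Fin n) →* ℤˣ)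
    (hε : ∀ σ, ε' (σ.viaEmbedding ι) = ε σ) :
    symS F κ' ε' Finset.univ * iot F ι (symS F κ ε Finset.univ) =
      ((keyGrp κ Finset.univ).card : F) • symS F κ' ε' Finset.univ := by
  conv_lhs => rw [symS.eq_def F κ]
  rw [map_sum, Finset.mul_sum, Finset.card_eq_sum_ones]
  push_cast
  rw [Finset.sum_smul]
  refine Finset.sum_congr rfl fun σ hσ => ?_
  rw [map_smul, iot_sg, mul_smul_comm, symS_mul_sg (via_key ι h hσ), hε, smul_smul, eps_mul_self]

lemma iot_symS {k n : ℕ} (ι : Fin k ↪ Fin n) {κ : Fin k → ℕ} {κ' : Fin n → ℕ}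
    (h : ∀ x, κ' (ι x) = κ x) (ε : Equiv.Perm (Fin k) →* ℤˣ) (ε' : Equiv.Perm (Fin n) →* ℤˣ)
    (hε : ∀ σ, ε' (σ.viaEmbedding ι) = ε σ) :
    iot F ι (symS F κ ε Finset.univ) * symS F κ' ε' Finset.univ =
      ((keyGrp κ Finset.univ).card : F) • symS F κ' ε' Finset.univ := by
  conv_lhs => rw [symS.eq_def F κ]
  rw [map_sum, Finset.sum_mul, Finset.card_eq_sum_ones]
  push_cast
  rw [Finset.sum_smul]
  refine Finset.sum_congr rfl fun σ hσ => ?_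
  rw [map_smul, iot_sg, smul_mul_assoc, sg_mul_symS (via_key ι h hσ), hε, smul_smul, eps_mul_self]

lemma rect_zero {d l : ℕ} (ν : NPartition ((d + 1) * (l + 1)))
    (hν : ∀ j, j < d + 1 → ν.part j = l + 1) (j : ℕ) (hj : d + 1 ≤ j) : ν.part j = 0 := by
  by_contra hn
  have hjk : j < (d + 1) * (l + 1) := by
    by_contra h
    exact hn (ν.part_eq_zero j (not_lt.1 h))
  have h1 : ∑ i ∈ Finset.range (d + 1), ν.part i = (d + 1) * (l + 1) := by
    rw [Finset.sum_congr rfl fun i hi => hν i (Finset.mem_range.1 hi)]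
    simp
  have h2 : ∑ i ∈ insert j (Finset.range (d + 1)), ν.part i ≤ (d + 1) * (l + 1) := by
    conv_rhs => rw [← ν.sum_eq]
    apply Finset.sum_le_sum_of_subset
    intro i hi
    simp only [Finset.mem_insert, Finset.mem_range] at hi ⊢
    rcases hi with rfl | hi
    · exact hjk
    · omega
  rw [Finset.sum_insert (by simp; omega), h1] at h2
  omega

lemma alg_aux {G : Type*} [Group G] [Fintype G] {Y R C R' C' E Z : GA F G} {a b c : F}
    (h1 : R * R' = a • R) (h2 : C' * C = b • C) (ha : a ≠ 0) (hb : b ≠ 0)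
    (hy : Y = R * C) (hy' : E = R' * C') (hc' : E = c • (Z * E)) : Y ∈ tspan F {Z} := by
  have h3 : (a * b) • Y = c • (R * Z * (E * C)) := by
    rw [hy, ← smul_mul_smul_comm, ← h1, ← h2]
    have : R * R' * (C' * C) = R * E * C := by
      rw [hy']; simp only [mul_assoc]
    rw [this]
    conv_lhs => rw [hc']
    simp only [mul_assoc, mul_smul_comm, smul_mul_assoc]
  have h4 : Y = (a * b)⁻¹ • ((a * b) • Y) := by
    rw [smul_smul, inv_mul_cancel₀ (mul_ne_zero ha hb), one_smul]
  rw [h4, h3]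
  exact Submodule.smul_mem _ _ (Submodule.smul_mem _ _ (tspan_mem (Set.mem_singleton Z) _ _))

lemma young_mem_chi_aux [CharZero F] {k n : ℕ} (ν : NPartition k) (T' : YTableau ν)
    {μ : NPartition n} (T : YTableau μ) (ι : Fin k ↪ Fin n)
    (hr : ∀ x, rowF T (ι x) = rowF T' x) (hcl : ∀ x, colF T (ι x) = colF T' x) :
    youngSym F T ∈ tspan F {iot F ι (zchi F T')} := by
  have h1 := symS_iot (F := F) ι hr 1 1 (fun _ => rfl)
  have h2 := iot_symS (F := F) ι hcl Equiv.Perm.sign Equiv.Perm.sign (via_sign ι)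
  obtain ⟨c, hc⟩ := young_zchi (F := F) T'
  have hc' := congrArg (iot F ι) hc
  rw [map_smul, map_mul] at hc'
  have hy' := congrArg (iot F ι) (youngSym_eq (F := F) T')
  rw [map_mul] at hy'
  exact alg_aux h1 h2 (card_key_ne _) (card_key_ne _) (youngSym_eq T) hy' hc'

/-- K1 -/
lemma young_mem_chi [CharZero F] {d l n : ℕ} (ν : NPartition ((d + 1) * (l + 1)))
    (hν : ∀ j, j < d + 1 → ν.part j = l + 1) (T' : YTableau ν)
    {μ : NPartition n} (hμ : ¬ InHook d l μ) (T : YTableau μ) :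
    ∃ ι : Fin ((d + 1) * (l + 1)) ↪ Fin n,
      youngSym F T ∈ tspan F {iot F ι (zchi F T')} := by
  have hc : ∀ c : ν.Cell, c.1.2 < μ.part c.1.1 := by
    intro c
    have h1 := c.2
    unfold InHook at hμ
    by_cases hd : c.1.1 < d + 1
    · rw [hν _ hd] at h1
      have := μ.antitone (show c.1.1 ≤ d by omega)
      omega
    · rw [rect_zero ν hν _ (by omega)] at h1
      omega
  let f : Fin ((d + 1) * (l + 1)) → Fin n := fun x => T.symm ⟨(T' x).1, hc _⟩
  have hf : Function.Injective f := by
    intro x y h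
    have := T.symm.injective h
    rw [Subtype.mk.injEq] at this
    exact T'.injective (Subtype.ext this)
  have hT : ∀ x, T (f x) = ⟨(T' x).1, hc _⟩ := fun x => T.apply_symm_apply _
  refine ⟨⟨f, hf⟩, young_mem_chi_aux ν T' T ⟨f, hf⟩ ?_ ?_⟩
  · intro x; change (T (f x)).1.1 = _; rw [hT]; rfl
  · intro x; change (T (f x)).1.2 = _; rw [hT]; rfl

lemma tspan_ideal {G : Type*} [Group G] [Fintype G] {S : Set (GA F G)} {w : GA F G}
    (hw : w ∈ tspan F S) (x y : GA F G) : x * w * y ∈ tspan F S := by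
  induction hw using Submodule.span_induction with
  | mem w h =>
    obtain ⟨u, hu, g, h, rfl⟩ := h
    have := tspan_mem hu (x * sg F g) (sg F h * y)
    simpa only [mul_assoc] using this
  | zero => simp
  | add a b _ _ ha hb => rw [mul_add, add_mul]; exact add_mem ha hb
  | smul c a _ ha => rw [mul_smul_comm, smul_mul_assoc]; exact Submodule.smul_mem _ _ ha

variable (F) in
def qq {n : ℕ} (t : F) (L1 : List (Fin n)) : List (Fin n) → GA F (Equiv.Perm (Fin n))
  | [] => 1
  | a :: L => qq t L1 L * (t • 1 + jm F (L ++ L1) a)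

lemma zz_append {n : ℕ} (t : F) (L1 L : List (Fin n)) :
    zz F t (L ++ L1) = zz F t L1 * qq F t L1 L := by
  induction L with
  | nil => simp [qq]
  | cons a L ih => rw [List.cons_append, zz, qq, ih, mul_assoc]

lemma qq_commute {n : ℕ} (t : F) (L1 L : List (Fin n)) (hN : (L ++ L1).Nodup)
    {g : Equiv.Perm (Fin n)} (hg : ∀ x, x ∉ L1 → g x = x) :
    sg F g * qq F t L1 L = qq F t L1 L * sg F g := by
  induction L with
  | nil => simp [qq]
  | cons a L ih =>
    rw [List.cons_append, List.nodup_cons] at hN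
    rw [qq, ← mul_assoc, ih hN.2, mul_assoc, mul_assoc]
    congr 1
    rw [mul_add, add_mul, jm_commute hN.2 (fun x hx => hg x (by simp at hx; exact hx.2)) hN.1]
    simp

lemma qq_poly {n : ℕ} (L1 L : List (Fin n)) (x : GA F (Equiv.Perm (Fin n)))
    (g : Equiv.Perm (Fin n)) :
    ∃ p : Polynomial F, ∀ t, (x * qq F t L1 L).coeff g = p.eval t := by
  induction L generalizing g with
  | nil => exact ⟨Polynomial.C (x.coeff g), by simp [qq]⟩
  | cons a L ih =>
    choose p hp using ih
    refine ⟨Polynomial.X * p g + ∑ h, Polynomial.C ((jm F (L ++ L1) a).coeff h) * p (g * h⁻¹), ?_⟩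
    intro t
    rw [qq, ← mul_assoc, mul_add, MonoidAlgebra.coeff_add, Finsupp.add_apply]
    conv_lhs => rw [sg_expand (jm F (L ++ L1) a)]
    rw [Finset.mul_sum, MonoidAlgebra.coeff_sum, Finset.sum_apply']
    simp only [Polynomial.eval_add, Polynomial.eval_mul, Polynomial.eval_X, Polynomial.eval_C,
      Polynomial.eval_finsetSum, ← hp, mul_smul_comm, mul_one, MonoidAlgebra.coeff_smul,
      Finsupp.smul_apply, smul_eq_mul, coeff_mul_sg]

lemma iot_zz {k n : ℕ} (ι : Fin k ↪ Fin n) (t : F) (L : List (Fin k)) :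
    iot F ι (zz F t L) = zz F t (L.map ι) := by
  induction L with
  | nil => simp [zz]
  | cons a L ih =>
    rw [List.map_cons, zz, zz, map_mul, ih, map_add, map_smul, map_one]
    congr 2
    unfold jm
    rw [map_list_sum, List.map_map, List.map_map]
    congr 1
    apply List.map_congr_left
    intro b _
    simp only [Function.comp, iot_sg, via_swap]

lemma branch_poly [CharZero F] {k n : ℕ} (ι : Fin k ↪ Fin n) {ν : NPartition k} (T' : YTableau ν)
    {μ : NPartition n} (T : YTableau μ) (g : Equiv.Perm (Fin n)) :
    ∃ p : Polynomial F, ∀ t,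
      (∏ x, (t - ((rowF T x : F) - (colF T x : F)))) * (zeta F T * iot F ι (youngSym F T')).coeff g =
      (∏ x, (t - ((rowF T' x : F) - (colF T' x : F)))) * p.eval t := by
  let L1 := (List.finRange k).map ι
  let L2 := (List.finRange n).filter (fun x => x ∉ L1)
  have hN1 : L1.Nodup := (List.nodup_finRange k).map ι.injective
  have hN : (L2 ++ L1).Nodup := by
    rw [List.nodup_append]
    refine ⟨(List.nodup_finRange n).filter _, hN1, ?_⟩
    intro a ha b hb hab
    subst hab
    simp only [L2, List.mem_filter, decide_eq_true_eq] at ha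
    exact ha.2 hb
  have hF : ∀ x, x ∈ L2 ++ L1 := by
    intro x
    by_cases hx : x ∈ L1
    · simp [hx]
    · simp [L2, hx]
  obtain ⟨p, hp⟩ := qq_poly (F := F) L1 L2 (zeta F T * iot F ι (youngSym F T')) g
  refine ⟨p, fun t => ?_⟩
  rw [← hp]
  have e1 := cen_mul_zeta T (zz_cen t hN hF)
  rw [content_formula t T _ hN hF] at e1
  have e2 := cen_mul_young T' (zz_cen t (List.nodup_finRange k) (List.mem_finRange))
  rw [content_formula t T' _ (List.nodup_finRange k) List.mem_finRange] at e2
  have hq : iot F ι (youngSym F T') * qq F t L1 L2 = qq F t L1 L2 * iot F ι (youngSym F T') := by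
    rw [sg_expand (youngSym F T'), map_sum, Finset.sum_mul, Finset.mul_sum]
    refine Finset.sum_congr rfl fun σ _ => ?_
    rw [map_smul, smul_mul_assoc, mul_smul_comm, iot_sg, qq_commute t L1 L2 hN]
    intro x hx
    apply Equiv.Perm.viaEmbedding_apply_of_notMem
    simpa [L1] using hx
  have hmain : (∏ x, (t - ((rowF T x : F) - (colF T x : F)))) •
      (zeta F T * iot F ι (youngSym F T')) =
      (∏ x, (t - ((rowF T' x : F) - (colF T' x : F)))) •
        (zeta F T * iot F ι (youngSym F T') * qq F t L1 L2) := by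
    have r1 : (∏ x, (t - ((rowF T x : F) - (colF T x : F)))) =
        ∏ x, (t + (colF T x : F) - (rowF T x : F)) :=
      Finset.prod_congr rfl fun x _ => by ring
    have r2 : (∏ x, (t - ((rowF T' x : F) - (colF T' x : F)))) =
        ∏ x, (t + (colF T' x : F) - (rowF T' x : F)) :=
      Finset.prod_congr rfl fun x _ => by ring
    rw [r1, r2, ← smul_mul_assoc, ← e1, ← cen_comm (zz_cen t hN hF), zz_append, mul_assoc,
      mul_assoc, ← hq, mul_assoc, ← mul_assoc (zz F t L1), ← iot_zz, ← map_mul, e2, map_smul,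
      smul_mul_assoc, mul_smul_comm]
  have := congrArg (fun y => y.coeff g) hmain
  simpa using this

lemma zeta_iot_zero [CharZero F] {d l n : ℕ} (ν : NPartition ((d + 1) * (l + 1)))
    (hν : ∀ j, j < d + 1 → ν.part j = l + 1) (T' : YTableau ν)
    {μ : NPartition n} (hμ : InHook d l μ) (T : YTableau μ)
    (ι : Fin ((d + 1) * (l + 1)) ↪ Fin n) : zeta F T * iot F ι (youngSym F T') = 0 := by
  by_contra hne
  obtain ⟨g, hg⟩ : ∃ g, (zeta F T * iot F ι (youngSym F T')).coeff g ≠ 0 := by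
    by_contra h
    push Not at h
    exact hne (by ext g; simpa using h g)
  obtain ⟨p, hp⟩ := branch_poly (F := F) ι T' T g
  have h1 := count_le_of_poly _ _ p _ hg hp ((d : F) - (l : F))
  have key : ∀ a b : ℕ, ((a : F) - (b : F) = (d : F) - (l : F)) ↔ a + l = d + b := by
    intro a b
    rw [sub_eq_sub_iff_add_eq_add]
    exact_mod_cast Iff.rfl
  simp only [key] at h1
  have hsmall : ∀ x, rowF T x + l = d + colF T x → rowF T x < d := by
    intro x hx
    by_contra hn
    have h2 := colF_lt T x
    have h3 := μ.antitone (show d ≤ rowF T x by omega)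
    unfold InHook at hμ
    omega
  have h2 : (Finset.univ.filter fun x => rowF T x + l = d + colF T x).card ≤ min d l := by
    apply le_min
    · conv_rhs => rw [← Finset.card_range d]
      refine Finset.card_le_card_of_injOn (rowF T) ?_ ?_
      · intro x hx
        have := hsmall x (by simpa using hx)
        simpa using this
      · intro x hx y hy h
        simp only [Finset.coe_filter, Finset.mem_univ, true_and, Set.mem_ofPred_eq] at hx hy
        exact rowF_colF_inj T x y h (by omega)
    · conv_rhs => rw [← Finset.card_range l]
      refine Finset.card_le_card_of_injOn (colF T) ?_ ?_
      · intro x hx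
        simp only [Finset.coe_filter, Finset.mem_univ, true_and, Set.mem_ofPred_eq] at hx
        have := hsmall x hx
        simp only [Finset.coe_range, Set.mem_Iio]
        omega
      · intro x hx y hy h
        simp only [Finset.coe_filter, Finset.mem_univ, true_and, Set.mem_ofPred_eq] at hx hy
        exact rowF_colF_inj T x y (by omega) h
  have h3 : min d l + 1 ≤ (Finset.univ.filter fun x => rowF T' x + l = d + colF T' x).card := by
    have hex : ∀ s : ℕ, s < min d l + 1 → ∃ x, rowF T' x = d - s ∧ colF T' x = l - s := by
      intro s hs
      apply exists_cell
      rw [hν _ (by omega)]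
      omega
    choose! f hf using hex
    conv_lhs => rw [← Finset.card_range (min d l + 1)]
    refine Finset.card_le_card_of_injOn f ?_ ?_
    · intro s hs
      simp only [Finset.coe_range, Set.mem_Iio] at hs
      have := hf s hs
      simp only [Finset.coe_filter, Finset.mem_univ, true_and, Set.mem_ofPred_eq]
      omega
    · intro s hs s' hs' h
      simp only [Finset.coe_range, Set.mem_Iio] at hs hs'
      have h4 := hf s hs
      have h5 := hf s' hs'
      rw [h] at h4
      omega
  omega

/-- K2 -/
lemma chi_mem_young [CharZero F] {d l n : ℕ} (ν : NPartition ((d + 1) * (l + 1)))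
    (hν : ∀ j, j < d + 1 → ν.part j = l + 1) (T' : YTableau ν)
    (ι : Fin ((d + 1) * (l + 1)) ↪ Fin n) :
    iot F ι (zchi F T') ∈ tspan F {w | ∃ (μ : NPartition n) (T : YTableau μ),
      ¬ InHook d l μ ∧ w = youngSym F T} := by
  obtain ⟨c, -, hc⟩ := zchi_eq (F := F) T'
  rw [hc, map_smul]
  refine Submodule.smul_mem _ _ ?_
  unfold zeta
  rw [map_sum]
  refine sum_mem fun g _ => ?_
  rw [map_mul, map_mul]
  apply tspan_ideal
  have h1 : (1 : GA F (Equiv.Perm (Fin n))) ∈ cen F n := by rw [mem_cen]; simp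
  obtain ⟨a, ha⟩ := cen_span (fun μ => (cell_finite μ).some) h1
  rw [← one_mul (iot F ι _), ha, Finset.sum_mul]
  refine sum_mem fun μ _ => ?_
  rw [smul_mul_assoc]
  refine Submodule.smul_mem _ _ ?_
  by_cases hμ : InHook d l μ
  · rw [zeta_iot_zero ν hν T' hμ]
    exact zero_mem _
  · exact zeta_tspan _ (Set.mem_ofPred.2 ⟨μ, _, hμ, rfl⟩) _

lemma one_mem_young [CharZero F] (n : ℕ) :
    (1 : GA F (Equiv.Perm (Fin n))) ∈ tspan F {w | ∃ (μ : NPartition n) (T : YTableau μ),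
      w = youngSym F T} := by
  have h1 : (1 : GA F (Equiv.Perm (Fin n))) ∈ cen F n := by rw [mem_cen]; simp
  obtain ⟨a, ha⟩ := cen_span (fun μ => (cell_finite μ).some) h1
  rw [ha]
  refine sum_mem fun μ _ => ?_
  refine Submodule.smul_mem _ _ ?_
  rw [← mul_one (zeta F _)]
  exact zeta_tspan _ (Set.mem_ofPred.2 ⟨μ, _, rfl⟩) _

end Branch


/-! ### Translation to multilinear polynomials -/
section Trans
variable {F : Type*} [Field F]

lemma multilin_span {I : Type*} [Fintype I] {E : I → Type*} [∀ t, AddCommGroup (E t)]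
    [∀ t, Module F (E t)] {B : Type*} [AddCommGroup B] [Module F B]
    (f : MultilinearMap F E B) (X : ∀ t, Set (E t)) (h : ∀ u, (∀ t, u t ∈ X t) → f u = 0)
    (u : ∀ t, E t) (hu : ∀ t, u t ∈ Submodule.span F (X t)) : f u = 0 := by
  have : ∀ s : Finset I, ∀ u : (∀ t, E t), (∀ t ∈ s, u t ∈ Submodule.span F (X t)) →
      (∀ t, t ∉ s → u t ∈ X t) → f u = 0 := by
    intro s
    induction s using Finset.induction_on with
    | empty => intro u _ h2; exact h u fun t => h2 t (by simp)
    | insert i s his ih =>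
      intro u h1 h2
      have key : ∀ x ∈ Submodule.span F (X i), f (Function.update u i x) = 0 := by
        intro x hx
        induction hx using Submodule.span_induction with
        | mem x hx =>
          apply ih
          · intro t ht
            rw [Function.update_of_ne (by rintro rfl; exact his ht)]
            exact h1 t (by simp [ht])
          · intro t ht
            by_cases hti : t = i
            · subst hti; simpa using hx
            · rw [Function.update_of_ne hti]
              exact h2 t (by simp [hti, ht])
        | zero => exact f.map_update_zero u i
        | add a b _ _ ha hb => rw [f.map_update_add, ha, hb, add_zero]
        | smul c a _ ha => rw [f.map_update_smul, ha, smul_zero]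
      have := key (u i) (h1 i (by simp))
      rwa [Function.update_eq_self] at this
  exact this Finset.univ u (fun t _ => hu t) (by simp)

variable {A : Type*} [NonUnitalRing A] [Module F A]
    [SMulCommClass F A A] [IsScalarTower F A A]

def hat {n : Fin 4 → ℕ} (g : MGroup n) : Equiv.Perm (MVar n) := Equiv.sigmaCongrRight g

lemma hat_apply {n : Fin 4 → ℕ} (g : MGroup n) (v : MVar n) : hat g v = ⟨v.1, g v.1 v.2⟩ := rfl

variable (F) in
def coeffL {G : Type*} (g : G) : GA F G →ₗ[F] F where
  toFun x := x.coeff g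
  map_add' x y := by simp
  map_smul' c x := by simp

variable (F) in
def MM {n : Fin 4 → ℕ} (a : MVar n → A) (ord : Fin (∑ i, n i) ≃ MVar n) :
    MultilinearMap F (fun t : Fin 4 => GA F (Equiv.Perm (Fin (n t)))) A :=
  ∑ g : MGroup n, ((MultilinearMap.mkPiAlgebra F (Fin 4) F).compLinearMap
    (fun t => coeffL F (g t))).smulRight (finProd fun j => a (hat g (ord j)))

lemma MM_apply {n : Fin 4 → ℕ} (a : MVar n → A) (ord : Fin (∑ i, n i) ≃ MVar n)
    (u : ∀ t : Fin 4, GA F (Equiv.Perm (Fin (n t)))) :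
    MM F a ord u = ∑ g : MGroup n, (∏ t, (u t).coeff (g t)) •
      finProd fun j => a (hat g (ord j)) := by
  simp [MM]
  rfl

lemma MM_sg {n : Fin 4 → ℕ} (a : MVar n → A) (ord : Fin (∑ i, n i) ≃ MVar n) (g : MGroup n) :
    MM F a ord (fun t => sg F (g t)) = finProd fun j => a (hat g (ord j)) := by
  rw [MM_apply, Finset.sum_eq_single g]
  · simp [sg_coeff]
  · intro h _ hne
    obtain ⟨t, ht⟩ := Function.ne_iff.1 hne
    rw [Finset.prod_eq_zero (Finset.mem_univ t), zero_smul]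
    rw [sg_coeff, if_neg (Ne.symm ht)]
  · simp

lemma MM_conj {n : Fin 4 → ℕ} (a : MVar n → A) (ord : Fin (∑ i, n i) ≃ MVar n)
    (u : ∀ t : Fin 4, GA F (Equiv.Perm (Fin (n t)))) (x y : MGroup n) :
    MM F a ord (fun t => sg F (x t) * u t * sg F (y t)) =
      MM F (a ∘ hat x) (ord.trans (hat y)) u := by
  rw [MM_apply, MM_apply]
  refine Fintype.sum_equiv ((Equiv.mulLeft x⁻¹).trans (Equiv.mulRight y⁻¹)) _ _ fun g => ?_
  congr 1
  · refine Finset.prod_congr rfl fun t _ => ?_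
    rw [coeff_mul_sg, coeff_sg_mul]
    simp [mul_assoc]
  · congr 1
    funext j
    simp [hat_apply]

lemma young_coeff {k : ℕ} {μ : NPartition k} (T : YTableau μ) (h : Equiv.Perm (Fin k)) :
    (youngSym F T).coeff h = ∑ σ ∈ Finset.univ.filter (· ∈ rowStab T),
      ∑ τ ∈ Finset.univ.filter (· ∈ colStab T),
      ((Equiv.Perm.sign τ : ℤ) : F) * if σ * τ = h then 1 else 0 := by
  unfold youngSym
  rw [MonoidAlgebra.coeff_sum, Finset.sum_apply']
  refine Finset.sum_congr rfl fun σ _ => ?_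
  rw [MonoidAlgebra.coeff_sum, Finset.sum_apply']
  refine Finset.sum_congr rfl fun τ _ => ?_
  rw [MonoidAlgebra.coeff_smul, Finsupp.smul_apply]
  have := sg_coeff (F := F) (σ * τ) h
  unfold sg at this
  rw [this, zsmul_eq_mul]
  split_ifs <;> rfl

lemma multi_coeff {n : Fin 4 → ℕ} {μ : ∀ i : Fin 4, NPartition (n i)}
    (T : ∀ i : Fin 4, YTableau (μ i)) (g : MGroup n) :
    ∏ t, (youngSym F (T t)).coeff (g t) =
      ∑ σ ∈ Finset.univ.filter (fun σ : MGroup n => ∀ i, σ i ∈ rowStab (T i)),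
        ∑ τ ∈ Finset.univ.filter (fun τ : MGroup n => ∀ i, τ i ∈ colStab (T i)),
      ((∏ i, (Equiv.Perm.sign (τ i) : ℤ) : ℤ) : F) * if σ * τ = g then 1 else 0 := by
  simp only [young_coeff]
  rw [Finset.prod_univ_sum]
  refine Finset.sum_congr ?_ fun σ _ => ?_
  · ext σ; simp [Fintype.mem_piFinset]
  rw [Finset.prod_univ_sum]
  refine Finset.sum_congr ?_ fun τ _ => ?_
  · ext σ; simp [Fintype.mem_piFinset]
  rw [Finset.prod_mul_distrib]
  push_cast
  congr 1
  split_ifs with h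
  · rw [← h]; simp
  · obtain ⟨t, ht⟩ := Function.ne_iff.1 h
    exact Finset.prod_eq_zero (Finset.mem_univ t) (if_neg ht)

lemma eval_symAct {n : Fin 4 → ℕ} {μ : ∀ i : Fin 4, NPartition (n i)}
    (T : ∀ i : Fin 4, YTableau (μ i)) (f : MPoly F n) (a : MVar n → A) :
    ∑ ord : Fin (∑ i, n i) ≃ MVar n, (symAct F T f) ord • finProd (fun j => a (ord j)) =
    ∑ ord : Fin (∑ i, n i) ≃ MVar n, f ord • MM F a ord (fun t => youngSym F (T t)) := by
  have h1 : ∀ ord : Fin (∑ i, n i) ≃ MVar n, MM F a ord (fun t => youngSym F (T t)) =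
      ∑ σ ∈ Finset.univ.filter (fun σ : MGroup n => ∀ i, σ i ∈ rowStab (T i)),
        ∑ τ ∈ Finset.univ.filter (fun τ : MGroup n => ∀ i, τ i ∈ colStab (T i)),
      ((∏ i, (Equiv.Perm.sign (τ i) : ℤ) : ℤ) : F) • finProd fun j => a (hat (σ * τ) (ord j)) := by
    intro ord
    rw [MM_apply]
    simp only [multi_coeff, Finset.sum_smul]
    rw [Finset.sum_comm]
    refine Finset.sum_congr rfl fun σ _ => ?_
    rw [Finset.sum_comm]
    refine Finset.sum_congr rfl fun τ _ => ?_
    rw [Finset.sum_eq_single (σ * τ)]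
    · simp
    · intro g _ hg
      rw [if_neg (Ne.symm hg)]; simp
    · simp
  simp only [h1, symAct, Finset.sum_apply, Finset.sum_smul, Finset.smul_sum]
  rw [Finset.sum_comm]
  conv_rhs => rw [Finset.sum_comm]
  refine Finset.sum_congr rfl fun σ _ => ?_
  rw [Finset.sum_comm]
  conv_rhs => rw [Finset.sum_comm]
  refine Finset.sum_congr rfl fun τ _ => ?_
  refine Fintype.sum_equiv ((Equiv.refl _).equivCongr (hat (σ * τ)).symm) _ _ fun ord => ?_
  have h2 : ∀ g : MGroup n, (Equiv.sigmaCongrRight fun i => ((g i)⁻¹ : Equiv.Perm (Fin (n i)))) =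
      (hat g).symm := fun g => rfl
  have h3 : ((Equiv.refl _).equivCongr (hat (σ * τ)).symm) ord = ord.trans (hat (σ * τ)).symm := rfl
  rw [h3, Pi.smul_apply, permMPoly, h2]
  rw [smul_comm, ← Int.cast_smul_eq_zsmul F, smul_assoc]
  rw [smul_comm]
  simp
  rw [smul_comm]

variable (S : SuperAlg F A)

lemma adm_hat {n : Fin 4 → ℕ} {a : MVar n → A} (ha : ∀ v, a v ∈ S.comp v.1) (x : MGroup n) :
    ∀ v, (a ∘ hat x) v ∈ S.comp v.1 := fun v => ha (hat x v)

lemma identity_iff {n : Fin 4 → ℕ} {μ : ∀ i : Fin 4, NPartition (n i)}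
    (T : ∀ i : Fin 4, YTableau (μ i)) :
    (∀ f : MPoly F n, MIsIdentity S (symAct F T f)) ↔
    ∀ a : MVar n → A, (∀ v, a v ∈ S.comp v.1) → ∀ ord,
      MM F a ord (fun t => youngSym F (T t)) = 0 := by
  constructor
  · intro h a ha ord
    have h1 := h (Pi.single ord 1) a ha
    rw [eval_symAct, Finset.sum_eq_single ord] at h1
    · simpa using h1
    · intro o _ ho
      rw [Pi.single_eq_of_ne ho, zero_smul]
    · simp
  · intro h f a ha
    rw [eval_symAct]
    exact Finset.sum_eq_zero fun ord _ => by rw [h a ha ord, smul_zero]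

lemma MM_tspan {n : Fin 4 → ℕ} (X : ∀ t, Set (GA F (Equiv.Perm (Fin (n t)))))
    (h : ∀ u : (∀ t, GA F (Equiv.Perm (Fin (n t)))), (∀ t, u t ∈ X t) →
      ∀ a : MVar n → A, (∀ v, a v ∈ S.comp v.1) → ∀ ord, MM F a ord u = 0)
    (u : ∀ t, GA F (Equiv.Perm (Fin (n t)))) (hu : ∀ t, u t ∈ tspan F (X t))
    (a : MVar n → A) (ha : ∀ v, a v ∈ S.comp v.1) (ord : Fin (∑ i, n i) ≃ MVar n) :
    MM F a ord u = 0 := by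
  refine multilin_span (MM F a ord) _ ?_ u hu
  intro w hw
  choose u' hu' x y hxy using fun t => Set.mem_ofPred.1 (hw t)
  have : w = fun t => sg F (x t) * u' t * sg F (y t) := funext hxy
  rw [this, MM_conj]
  exact h u' hu' _ (adm_hat S ha x) _

def ChiVan (d l : Fin 4 → ℕ) : Prop :=
  ∀ i : Fin 4, ∀ ν : NPartition ((d i + 1) * (l i + 1)),
    (∀ j, j < d i + 1 → ν.part j = l i + 1) →
    ∀ T : YTableau ν, ∀ n : Fin 4 → ℕ, ∀ ι : Fin ((d i + 1) * (l i + 1)) ↪ Fin (n i),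
    ∀ a : MVar n → A, (∀ v, a v ∈ S.comp v.1) → ∀ ord : Fin (∑ i, n i) ≃ MVar n,
    MM F a ord (Function.update (fun _ => 1) i (iot F ι (zchi F T))) = 0

def rectP (d l : ℕ) : NPartition ((d + 1) * (l + 1)) where
  part := fun j => if j < d + 1 then l + 1 else 0
  antitone := by
    intro i j hij
    dsimp only
    split_ifs <;> omega
  part_eq_zero := by
    intro i hi
    have : d + 1 ≤ (d + 1) * (l + 1) := Nat.le_mul_of_pos_right _ (by omega)
    rw [if_neg (by omega)]
  sum_eq := by
    have : d + 1 ≤ (d + 1) * (l + 1) := Nat.le_mul_of_pos_right _ (by omega)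
    rw [← Finset.sum_filter]
    have h : (Finset.range ((d + 1) * (l + 1))).filter (fun j => j < d + 1) =
        Finset.range (d + 1) := by
      ext j; simp only [Finset.mem_filter, Finset.mem_range]; omega
    rw [h]; simp

lemma hook_iff_chi [CharZero F] (d l : Fin 4 → ℕ) :
    (∀ (n : Fin 4 → ℕ) (μ : ∀ i : Fin 4, NPartition (n i)),
        (∃ i, ¬ InHook (d i) (l i) (μ i)) →
        ∀ (T : ∀ i, YTableau (μ i)) (f : MPoly F n), MIsIdentity S (symAct F T f)) ↔
    ChiVan S d l := by
  constructor
  · intro h i ν hν T n ι a ha ord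
    refine MM_tspan S (fun t => {w | ∃ (μ : NPartition (n t)) (T : YTableau μ),
      (t = i → ¬ InHook (d t) (l t) μ) ∧ w = youngSym F T}) ?_ _ ?_ a ha ord
    · intro u hu a ha ord
      choose μ T hT hu using fun t => Set.mem_ofPred.1 (hu t)
      have : u = fun t => youngSym F (T t) := funext hu
      rw [this]
      exact (identity_iff S T).1 (h n μ ⟨i, hT i rfl⟩ T) a ha ord
    · intro t
      by_cases hti : t = i
      · subst hti
        rw [Function.update_self]
        simpa using chi_mem_young (F := F) ν hν T ι
      · rw [Function.update_of_ne hti]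
        simpa [hti] using one_mem_young (F := F) (n t)
  · rintro h n μ ⟨i, hi⟩ T
    rw [identity_iff]
    obtain ⟨T'⟩ := cell_finite (rectP (d i) (l i))
    have hr : ∀ j, j < d i + 1 → (rectP (d i) (l i)).part j = l i + 1 := fun j hj => if_pos hj
    obtain ⟨ι, hι⟩ := young_mem_chi (F := F) _ hr T' hi (T i)
    intro a ha ord
    refine MM_tspan S (fun t => {Function.update (β := fun t => GA F (Equiv.Perm (Fin (n t))))
      (fun _ => 1) i (iot F ι (zchi F T')) t}) ?_ _ ?_ a ha ord
    · intro u hu a ha ord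
      have : u = Function.update (β := fun t => GA F (Equiv.Perm (Fin (n t))))
          (fun _ => 1) i (iot F ι (zchi F T')) := funext fun t => hu t
      rw [this]
      exact h i _ hr T' n ι a ha ord
    · intro t
      by_cases hti : t = i
      · subst hti
        rw [Function.update_self]
        exact hι
      · rw [Function.update_of_ne hti]
        have := tspan_mem (F := F) (Set.mem_singleton (1 : GA F (Equiv.Perm (Fin (n t)))))
          1 (youngSym F (T t))
        simpa using this

end Trans


/-! ### Amitsur identities and words -/
section Words
variable {F : Type*} [Field F]
variable {A : Type*} [NonUnitalRing A] [Module F A]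
    [SMulCommClass F A A] [IsScalarTower F A A]

def JJ {n : Fin 4 → ℕ} {i : Fin 4} {k : ℕ} (ι : Fin k ↪ Fin (n i)) : Fin k ↪ MVar n :=
  ⟨fun x => ⟨i, ι x⟩, fun x y h => by
    exact ι.injective (sigma_mk_injective (β := fun t => Fin (n t)) h)⟩

lemma hat_via {n : Fin 4 → ℕ} {i : Fin 4} {k : ℕ} (ι : Fin k ↪ Fin (n i))
    (σ : Equiv.Perm (Fin k)) (v : MVar n) :
    hat (Function.update (β := fun t => Equiv.Perm (Fin (n t))) (fun _ => 1) i
      (σ.viaEmbedding ι)) v = σ.viaEmbedding (JJ ι) v := by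
  by_cases hv : v ∈ Set.range (JJ ι)
  · obtain ⟨x, rfl⟩ := hv
    rw [Equiv.Perm.viaEmbedding_apply, hat_apply]
    change (⟨i, Function.update (β := fun t => Equiv.Perm (Fin (n t))) (fun _ => 1) i
      (σ.viaEmbedding ι) i (ι x)⟩ : MVar n) = ⟨i, ι (σ x)⟩
    rw [Function.update_self, Equiv.Perm.viaEmbedding_apply]
  · rw [Equiv.Perm.viaEmbedding_apply_of_notMem _ _ _ hv, hat_apply]
    obtain ⟨t, y⟩ := v
    by_cases ht : t = i
    · subst ht
      have hy : y ∉ Set.range ι := by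
        rintro ⟨x, rfl⟩
        exact hv ⟨x, rfl⟩
      simp only [Function.update_self]
      rw [Equiv.Perm.viaEmbedding_apply_of_notMem _ _ _ hy]
    · simp only [Function.update_of_ne ht]
      rfl

lemma MM_chi {n : Fin 4 → ℕ} {i : Fin 4} {k : ℕ} (ι : Fin k ↪ Fin (n i))
    {ν : NPartition k} (T : YTableau ν) (a : MVar n → A) (ord : Fin (∑ i, n i) ≃ MVar n) :
    MM F a ord (Function.update (fun _ => 1) i (iot F ι (zchi F T))) =
    ∑ σ, idealChar F (youngSym F T) σ •
      finProd fun j => a (σ.viaEmbedding (JJ ι) (ord j)) := by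
  unfold zchi
  rw [map_sum, MultilinearMap.map_update_sum]
  refine Finset.sum_congr rfl fun σ _ => ?_
  rw [map_smul, MultilinearMap.map_update_smul, iot_sg]
  congr 1
  have : (Function.update (β := fun t => GA F (Equiv.Perm (Fin (n t)))) (fun _ => 1) i
      (sg F (σ.viaEmbedding ι))) = fun t => sg F (Function.update
      (β := fun t => Equiv.Perm (Fin (n t))) (fun _ => 1) i (σ.viaEmbedding ι) t) := by
    funext t
    by_cases ht : t = i
    · subst ht; simp
    · simp [Function.update_of_ne ht]
      rfl
  rw [this, MM_sg]
  simp only [hat_via]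

lemma inr_listProd : ∀ L : List A, L ≠ [] →
    (Unitization.inr (listProd L) : Unitization F A) = (L.map Unitization.inr).prod
  | [], h => absurd rfl h
  | [a], _ => by simp [listProd]
  | a :: b :: L, _ => by
    rw [listProd, Unitization.inr_mul, inr_listProd (b :: L) (by simp)]
    simp

variable (S : SuperAlg F A)

lemma mem_comp (i : Fin 4) (x : A) : x ∈ S.comp i ↔
    x ∈ (if i = 0 ∨ i = 1 then S.A0 else S.A1) ∧
    S.sharp x = (if i = 0 ∨ i = 2 then (1 : F) else (-1 : F)) • x := by
  simp only [SuperAlg.comp, Submodule.mem_inf, LinearMap.mem_ker, LinearMap.sub_apply, sub_eq_zero,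
    LinearMap.smul_apply, LinearMap.id_apply]

def gens : Set (Unitization F A) := {u | u = 1 ∨ ∃ t, ∃ x ∈ S.comp t, u = Unitization.inr x}

lemma span_gens [CharZero F] (u : Unitization F A) : u ∈ Submodule.span F (gens S) := by
  have hc : ∀ t, ∀ x ∈ S.comp t, (Unitization.inr x : Unitization F A) ∈
      Submodule.span F (gens S) := fun t x hx =>
    Submodule.subset_span (Set.mem_ofPred.2 (Or.inr ⟨t, x, hx, rfl⟩))
  have hs : ∀ x : A, x = (2⁻¹ : F) • (x + S.sharp x) + (2⁻¹ : F) • (x - S.sharp x) := by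
    intro x
    rw [← smul_add]
    have : x + S.sharp x + (x - S.sharp x) = (2 : F) • x := by rw [two_smul]; abel
    rw [this, smul_smul, inv_mul_cancel₀ two_ne_zero, one_smul]
  have h0 : ∀ x ∈ S.A0, (Unitization.inr x : Unitization F A) ∈ Submodule.span F (gens S) := by
    intro x hx
    rw [hs x, Unitization.inr_add, Unitization.inr_smul, Unitization.inr_smul]
    refine Submodule.add_mem _ (Submodule.smul_mem _ _ (hc 0 _ ?_))
      (Submodule.smul_mem _ _ (hc 1 _ ?_))
    · rw [mem_comp]
      refine ⟨by simpa using S.A0.add_mem hx (S.sharp_mem0 x hx), ?_⟩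
      simp [S.sharp_sharp, add_comm]
    · rw [mem_comp]
      refine ⟨by simpa using S.A0.sub_mem hx (S.sharp_mem0 x hx), ?_⟩
      simp [S.sharp_sharp]
  have h1 : ∀ x ∈ S.A1, (Unitization.inr x : Unitization F A) ∈ Submodule.span F (gens S) := by
    intro x hx
    rw [hs x, Unitization.inr_add, Unitization.inr_smul, Unitization.inr_smul]
    refine Submodule.add_mem _ (Submodule.smul_mem _ _ (hc 2 _ ?_))
      (Submodule.smul_mem _ _ (hc 3 _ ?_))
    · rw [mem_comp]
      refine ⟨by simpa using S.A1.add_mem hx (S.sharp_mem1 x hx), ?_⟩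
      simp [S.sharp_sharp, add_comm]
    · rw [mem_comp]
      refine ⟨by simpa using S.A1.sub_mem hx (S.sharp_mem1 x hx), ?_⟩
      simp [S.sharp_sharp]
  induction u using Unitization.ind with
  | inl_add_inr r x =>
    refine Submodule.add_mem _ ?_ ?_
    · have : (Unitization.inl r : Unitization F A) = r • 1 := by
        rw [← Unitization.inl_one, ← Unitization.inl_smul]; simp
      rw [this]
      exact Submodule.smul_mem _ _ (Submodule.subset_span (Set.mem_ofPred.2 (Or.inl rfl)))
    · have hx : x ∈ S.A0 ⊔ S.A1 := by rw [S.sup_eq_top]; trivial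
      obtain ⟨y, hy, z, hz, rfl⟩ := Submodule.mem_sup.1 hx
      rw [Unitization.inr_add]
      exact Submodule.add_mem _ (h0 y hy) (h1 z hz)

lemma amitsur_unit [CharZero F] {k : ℕ} (hk : 0 < k) (χ : Equiv.Perm (Fin k) → F) (a : Fin k → A)
    (H : ∀ b : Fin (k + 1) → Option A, (∀ j, ∀ x ∈ b j, ∃ t : Fin 4, x ∈ S.comp t) →
      ∑ σ : Equiv.Perm (Fin k), χ σ •
          listProd ((List.ofFn fun j : Fin k =>
              (b j.castSucc).toList ++ [a (σ j)]).flatten ++ (b (Fin.last _)).toList) = 0)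
    (b : Fin k → Unitization F A) (c : Unitization F A) :
    ∑ σ : Equiv.Perm (Fin k), χ σ • ((List.ofFn fun j =>
      b j * (Unitization.inr (a (σ j)) : Unitization F A)).prod * c) = 0 := by
  have key : ∀ (u : Unitization F A), u ∈ gens S → ∃ o : Option A,
      (∀ x ∈ o, ∃ t : Fin 4, x ∈ S.comp t) ∧
      (o.toList.map (Unitization.inr : A → Unitization F A)).prod = u := by
    intro u hu
    rcases Set.mem_ofPred.1 hu with rfl | ⟨t, x, hx, rfl⟩
    · exact ⟨none, by simp, by simp⟩
    · refine ⟨some x, ?_, by simp⟩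
      intro y hy
      obtain rfl : x = y := by simpa using hy
      exact ⟨t, hx⟩
  have s1 : ∀ b : Fin k → Unitization F A, (∀ j, b j ∈ gens S) → ∀ c ∈ gens S,
      ∑ σ : Equiv.Perm (Fin k), χ σ • ((List.ofFn fun j =>
      b j * (Unitization.inr (a (σ j)) : Unitization F A)).prod * c) = 0 := by
    intro b hb c hc
    choose o ho1 ho2 using fun j => key (b j) (hb j)
    obtain ⟨o', h1, h2⟩ := key c hc
    have := H (Fin.snoc (α := fun _ => Option A) o o') (by
      intro j
      refine Fin.lastCases ?_ (fun j => ?_) j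
      · simpa using h1
      · simpa using ho1 j)
    have := congrArg (Unitization.inrHom F F A) this
    rw [map_sum, map_zero] at this
    rw [← this]
    refine Finset.sum_congr rfl fun σ _ => ?_
    rw [map_smul]
    congr 1
    change _ = Unitization.inr _
    rw [inr_listProd]
    · simp only [Fin.snoc_castSucc, Fin.snoc_last, List.map_append, List.prod_append, h2]
      rw [List.map_flatten, List.prod_flatten, List.map_ofFn, List.map_ofFn]
      congr 3
      funext j
      simp [ho2]
    · obtain ⟨k, rfl⟩ : ∃ m, k = m + 1 := ⟨k - 1, by omega⟩
      simp [List.ofFn_succ]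
  have s2 : ∀ b : Fin k → Unitization F A, ∀ c ∈ gens S,
      ∑ σ : Equiv.Perm (Fin k), χ σ • ((List.ofFn fun j =>
      b j * (Unitization.inr (a (σ j)) : Unitization F A)).prod * c) = 0 := by
    intro b c hc
    let M : MultilinearMap F (fun _ : Fin k => Unitization F A) (Unitization F A) :=
      ∑ σ : Equiv.Perm (Fin k), χ σ • (LinearMap.mulRight F c).compMultilinearMap
        ((MultilinearMap.mkPiAlgebraFin F k (Unitization F A)).compLinearMap
          (fun j => LinearMap.mulRight F (Unitization.inr (a (σ j)) : Unitization F A)))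
    have hM : ∀ b, M b = ∑ σ : Equiv.Perm (Fin k), χ σ • ((List.ofFn fun j =>
      b j * (Unitization.inr (a (σ j)) : Unitization F A)).prod * c) := by
      intro b; simp [M]
    rw [← hM]
    exact multilin_span M (fun _ => gens S) (fun u hu => by rw [hM]; exact s1 u hu c hc) b
      (fun j => span_gens S (b j))
  have hc := span_gens S c
  induction hc using Submodule.span_induction with
  | mem x hx => exact s2 b x hx
  | zero => simp
  | add x y _ _ hx hy => simp only [mul_add, smul_add, Finset.sum_add_distrib, hx, hy, add_zero]
  | smul r x _ hx =>
    simp only [mul_smul_comm]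
    simp only [smul_comm _ r]
    rw [← Finset.smul_sum, hx, smul_zero]

lemma word_decomp {V X U : Type*} [Monoid U] (p : V → Option X) (e : V → U) : ∀ w : List V,
    ∃ (b : List U) (c : U), b.length = (w.filterMap p).length ∧
      ∀ f : X → U, (w.map (fun v => (p v).elim (e v) f)).prod =
        (List.zipWith (fun y x => y * f x) b (w.filterMap p)).prod * c
  | [] => ⟨[], 1, by simp, by simp⟩
  | v :: w => by
    obtain ⟨b, c, h1, h2⟩ := word_decomp p e w
    cases hv : p v with
    | some x =>
      refine ⟨1 :: b, c, by simp [hv, h1], fun f => ?_⟩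
      rw [List.filterMap_cons_some hv]
      simp [h2, hv, mul_assoc]
    | none =>
      rw [List.filterMap_cons_none hv]
      cases b with
      | nil =>
        refine ⟨[], e v * c, h1, fun f => ?_⟩
        simp [h2, hv]
      | cons y b =>
        refine ⟨(e v * y) :: b, c, h1, fun f => ?_⟩
        cases hx : w.filterMap p with
        | nil => simp [hx] at h1
        | cons x xs => simp [h2, hv, hx, mul_assoc]

lemma amitsur_word [CharZero F] {V : Type*} {k : ℕ} (hk : 0 < k) (χ : Equiv.Perm (Fin k) → F)
    (hχ : ∀ c g, χ (c * g * c⁻¹) = χ g) (J : Fin k ↪ V) (a : V → A) (i : Fin 4)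
    (ha : ∀ x, a (J x) ∈ S.comp i)
    (H : ∀ a : Fin k → A, (∀ j, a j ∈ S.comp i) →
      ∀ b : Fin (k + 1) → Option A, (∀ j, ∀ x ∈ b j, ∃ t : Fin 4, x ∈ S.comp t) →
      ∑ σ : Equiv.Perm (Fin k), χ σ •
          listProd ((List.ofFn fun j : Fin k =>
              (b j.castSucc).toList ++ [a (σ j)]).flatten ++ (b (Fin.last _)).toList) = 0)
    (w : List V) (hw : w.Nodup) (hw' : ∀ v, v ∈ w) :
    ∑ σ : Equiv.Perm (Fin k), χ σ • listProd (w.map fun v => a (σ.viaEmbedding J v)) = 0 := by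
  have hp : ∀ x v, Function.partialInv J v = some x ↔ J x = v :=
    Function.Injective.isPartialInv J.injective
  obtain ⟨b, c, hb, hbc⟩ := word_decomp (Function.partialInv J)
    (fun v => (Unitization.inr (a v) : Unitization F A)) w
  have hnd : (w.filterMap (Function.partialInv J)).Nodup := by
    refine hw.filterMap ?_
    intro v v' x hx hx'
    rw [Option.mem_def, hp] at hx hx'
    rw [← hx, ← hx']
  have hall : ∀ x, x ∈ w.filterMap (Function.partialInv J) := fun x =>
    List.mem_filterMap.2 ⟨J x, hw' _, (hp _ _).2 rfl⟩
  let E := List.Nodup.getEquivOfForallMemList _ hnd hall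
  have hlen : (w.filterMap (Function.partialInv J)).length = k := by
    simpa using Fintype.card_congr E
  let θ : Equiv.Perm (Fin k) := (finCongr hlen.symm).trans E
  have hxs : w.filterMap (Function.partialInv J) = List.ofFn θ := by
    refine List.ext_getElem (by simp [hlen]) ?_
    intro m h1 h2
    simp [θ, E]
  have hb' : b = List.ofFn fun j : Fin k => b[j.1]'(by rw [hb, hlen]; exact j.2) := by
    refine List.ext_getElem (by simp [hb, hlen]) ?_
    intro m h1 h2
    simp
  have main := amitsur_unit S hk χ (fun j => a (J (θ j))) (H _ fun j => ha _)
    (fun j => b[j.1]'(by rw [hb, hlen]; exact j.2)) c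
  have hwne : w ≠ [] := by
    rintro rfl
    simpa using hw' (J ⟨0, hk⟩)
  apply Unitization.inr_injective (R := F)
  change Unitization.inrHom F F A _ = Unitization.inr 0
  rw [map_sum, Unitization.inr_zero, ← main]
  refine Fintype.sum_equiv (MulAut.conj θ⁻¹).toEquiv _ _ fun σ => ?_
  rw [map_smul]
  have e1 : χ ((MulAut.conj θ⁻¹).toEquiv σ) = χ σ := by
    simpa using hχ θ⁻¹ σ
  rw [e1]
  congr 1
  change Unitization.inr _ = _
  rw [inr_listProd _ (by simpa using hwne), List.map_map]
  have e2 := hbc (fun x => (Unitization.inr (a (J (σ x))) : Unitization F A))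
  have e3 : (Unitization.inr ∘ fun v => a (σ.viaEmbedding J v) : V → Unitization F A) =
      fun v => (Function.partialInv J v).elim (Unitization.inr (a v))
        (fun x => (Unitization.inr (a (J (σ x))) : Unitization F A)) := by
    funext v
    cases hv : Function.partialInv J v with
    | some x =>
      rw [hp] at hv
      subst hv
      simp [Equiv.Perm.viaEmbedding_apply]
    | none =>
      have : v ∉ Set.range J := by
        rintro ⟨x, rfl⟩
        rw [(hp _ _).2 rfl] at hv
        simp at hv
      simp [Equiv.Perm.viaEmbedding_apply_of_notMem _ _ _ this]
  rw [e3, e2]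
  congr 2
  refine List.ext_getElem (by simp [hb, hlen]) ?_
  intro m h1 h2
  simp only [List.getElem_zipWith, List.getElem_ofFn, hxs]
  simp

lemma amitsur_to_chi [CharZero F] (d l : Fin 4 → ℕ) (h : SatisfiesAmitsur S d l) :
    ChiVan S d l := by
  intro i ν hν T n ι a ha ord
  rw [MM_chi]
  have := amitsur_word S (k := (d i + 1) * (l i + 1)) (by positivity)
    (idealChar F (youngSym F T)) (fun c g => idealChar_conj _ c g) (JJ ι) a i
    (fun x => ha (JJ ι x)) (fun a ha b hb => h i ν hν T a ha b hb) (List.ofFn ord)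
    (List.nodup_ofFn.2 ord.injective) (fun v => (List.mem_ofFn' _ _).2 (ord.surjective v))
  simpa [finProd, List.map_ofFn, Function.comp_def] using this

lemma word_ord {V : Type*} {n : Fin 4 → ℕ} (E : V ≃ MVar n) (w : List V) (hw : w.Nodup)
    (hw' : ∀ v, v ∈ w) : ∃ ord : Fin (∑ i, n i) ≃ MVar n, List.ofFn ord = w.map E := by
  let e := List.Nodup.getEquivOfForallMemList w hw hw'
  have hlen : w.length = ∑ i, n i := by
    simpa using Fintype.card_congr (e.trans E)
  refine ⟨(finCongr hlen.symm).trans (e.trans E), ?_⟩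
  refine List.ext_getElem (by simp [hlen]) ?_
  intro m h1 h2
  simp [e]

lemma chi_to_amitsur (d l : Fin 4 → ℕ) (h : ChiVan S d l) : SatisfiesAmitsur S d l := by
  intro i ν hν T a ha b hb
  have h' := h i ν hν T
  clear h hν
  revert ν
  generalize (d i + 1) * (l i + 1) = k at *
  intro ν T h
  choose ty hty using hb
  let V := Fin k ⊕ {j : Fin (k + 1) // (b j).isSome}
  let τ : V → Fin 4 := fun v => Sum.elim (fun _ => i) (fun j => ty j.1 _ (Option.get_mem j.2)) v
  let val : (Fin k → A) → V → A := fun f v => Sum.elim f (fun j => (b j.1).get j.2) v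
  let n : Fin 4 → ℕ := fun t => Fintype.card {v : V // τ v = t}
  let E : V ≃ MVar n := (Equiv.sigmaFiberEquiv τ).symm.trans
    (Equiv.sigmaCongrRight fun t => Fintype.equivFin {v : V // τ v = t})
  let ι : Fin k ↪ Fin (n i) := ⟨fun x => Fintype.equivFin {v : V // τ v = i} ⟨Sum.inl x, rfl⟩, by
    intro x y hxy
    exact Sum.inl.inj (congrArg Subtype.val ((Fintype.equivFin _).injective hxy))⟩
  have hE : ∀ x, E (Sum.inl x) = JJ ι x := fun x => rfl
  let ov : Fin (k + 1) → List V := fun j =>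
    if h : (b j).isSome then [Sum.inr ⟨j, h⟩] else []
  have hov : ∀ j f, (ov j).map (val f) = (b j).toList := by
    intro j f
    by_cases hj : (b j).isSome
    · simp only [ov, dif_pos hj, val, List.map_cons, Sum.elim_inr, List.map_nil]
      obtain ⟨x, hx⟩ := Option.isSome_iff_exists.1 hj
      simp [hx]
    · simp only [ov, dif_neg hj]
      have : b j = none := by simpa using hj
      simp [this]
  have hovm : ∀ j v, v ∈ ov j ↔ ∃ hj, v = Sum.inr ⟨j, hj⟩ := by
    intro j v
    by_cases hj : (b j).isSome
    · simp [ov, hj]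
    · simp [ov, hj]
  have hovn : ∀ j, (ov j).Nodup := by
    intro j
    by_cases hj : (b j).isSome
    · simp [ov, hj]
    · simp [ov, hj]
  let w : List V := (List.ofFn fun j : Fin k => ov j.castSucc ++ [Sum.inl j]).flatten ++
    ov (Fin.last k)
  have hw : w.Nodup := by
    refine List.Nodup.append (List.nodup_flatten.2 ⟨?_, ?_⟩) (hovn _) ?_
    · intro L hL
      obtain ⟨j, rfl⟩ := (List.mem_ofFn' _ _).1 hL
      refine List.Nodup.append (hovn _) (by simp) ?_
      intro v hv hv'
      obtain ⟨hj, rfl⟩ := (hovm _ _).1 hv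
      simp at hv'
    · rw [List.pairwise_ofFn]
      intro j j' hjj v hv hv'
      rw [List.mem_append, hovm] at hv hv'
      have hne : j ≠ j' := hjj.ne
      rcases hv with ⟨hj, rfl⟩ | hv <;> rcases hv' with ⟨hj', hv'⟩ | hv'
      · have := congrArg Subtype.val (Sum.inr.inj hv')
        exact hne (Fin.castSucc_injective _ this)
      · exact absurd (List.mem_singleton.1 hv') (by intro h; cases h)
      · simp [hv'] at hv
      · have h1 := List.mem_singleton.1 hv
        have h2 := List.mem_singleton.1 hv'
        exact hne (Sum.inl.inj (h1.symm.trans h2))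
    · intro v hv hv'
      obtain ⟨hj, rfl⟩ := (hovm _ _).1 hv'
      obtain ⟨L, hL, hvL⟩ := List.mem_flatten.1 hv
      obtain ⟨j, rfl⟩ := (List.mem_ofFn' _ _).1 hL
      rw [List.mem_append, hovm] at hvL
      rcases hvL with ⟨hj, h2⟩ | h2
      · have := congrArg Subtype.val (Sum.inr.inj h2)
        exact absurd this.symm (Fin.castSucc_lt_last j).ne
      · exact absurd (List.mem_singleton.1 h2) (by intro h; cases h)
  have hw' : ∀ v, v ∈ w := by
    intro v
    rw [List.mem_append]
    have hmem : ∀ j, ∀ v ∈ ov (Fin.castSucc j) ++ [(Sum.inl j : V)],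
        v ∈ (List.ofFn fun j : Fin k => ov j.castSucc ++ [(Sum.inl j : V)]).flatten :=
      fun j v hv => List.mem_flatten.2 ⟨_, (List.mem_ofFn' _ _).2 ⟨j, rfl⟩, hv⟩
    rcases v with x | ⟨j, hj⟩
    · exact Or.inl (hmem x _ (by simp))
    · revert hj
      refine Fin.lastCases (fun hj => Or.inr ?_) (fun j hj => Or.inl (hmem j _ ?_)) j
      · exact (hovm _ _).2 ⟨hj, rfl⟩
      · exact List.mem_append.2 (Or.inl ((hovm _ _).2 ⟨hj, rfl⟩))
  obtain ⟨ord, hord⟩ := word_ord E w hw hw'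
  have hadm : ∀ v : V, val a v ∈ S.comp (τ v) := by
    rintro (x | ⟨j, hj⟩)
    · exact ha x
    · exact hty j _ _
  have hτ : ∀ u : MVar n, τ (E.symm u) = u.1 := by
    intro u
    obtain ⟨v, rfl⟩ := E.surjective u
    rw [Equiv.symm_apply_apply]; rfl
  have := h n ι (fun u => val a (E.symm u)) (fun u => by
    have := hadm (E.symm u); rwa [hτ] at this) ord
  rw [MM_chi] at this
  rw [← this]
  refine Finset.sum_congr rfl fun σ _ => ?_
  congr 1
  have e1 : finProd (fun j => val a (E.symm (σ.viaEmbedding (JJ ι) (ord j)))) =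
      listProd ((List.ofFn ord).map fun u => val a (E.symm (σ.viaEmbedding (JJ ι) u))) := by
    simp [finProd, List.map_ofFn, Function.comp_def]
  rw [e1, hord, List.map_map]
  have e2 : ((fun u => val a (E.symm (σ.viaEmbedding (JJ ι) u))) ∘ E) =
      val (fun x => a (σ x)) := by
    funext v
    rcases v with x | j
    · simp only [Function.comp_apply, hE, Equiv.Perm.viaEmbedding_apply]
      rw [← hE, Equiv.symm_apply_apply]
      rfl
    · have : E (Sum.inr j) ∉ Set.range (JJ ι) := by
        rintro ⟨x, hx⟩
        rw [← hE] at hx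
        have := E.injective hx
        simp at this
      simp only [Function.comp_apply]
      rw [Equiv.Perm.viaEmbedding_apply_of_notMem _ _ _ this, Equiv.symm_apply_apply]
      rfl
  rw [e2]
  congr 1
  simp only [w, List.map_append, hov, List.map_flatten, List.map_ofFn]
  congr 3
  funext j
  simp only [Function.comp_apply, List.map_append, hov]
  rfl

end Words

/-- **Theorem 6.2: Amitsur `#`-superidentities characterize hook containment.**

Let `A` be a `#`-superalgebra over a field `F` of characteristic zero which is a
PI-algebra, and fix `d₁,l₁,…,d₄,l₄ ≥ 0`. Then `A` satisfies the Amitsur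
`#`-superidentity of rank `⟨d,l⟩` if and only if for every multidegree `⟨n⟩`, every
multipartition `⟨λ⟩ ⊢ ⟨n⟩` lying outside the quadruple hook
`(H(d₁,l₁),…,H(d₄,l₄))`, every Young multitableau `T⟨λ⟩` of shape `⟨λ⟩` and every
`f ∈ P⟨n⟩` one has `e_{T⟨λ⟩}·f ∈ Id₂#(A)` (i.e. the multiplicity `m⟨λ⟩` in the
`⟨n⟩`-th `#`-cocharacter of `A` vanishes outside the quadruple hook). -/
theorem amitsur_iff_hook
    (F A : Type*) [Field F] [CharZero F] [NonUnitalRing A] [Module F A]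
    [SMulCommClass F A A] [IsScalarTower F A A] (S : SuperAlg F A) (hPI : IsPI F A)
    (d l : Fin 4 → ℕ) :
    SatisfiesAmitsur S d l ↔
      ∀ (n : Fin 4 → ℕ) (μ : ∀ i : Fin 4, NPartition (n i)),
        (∃ i : Fin 4, ¬ InHook (d i) (l i) (μ i)) →
        ∀ (T : ∀ i : Fin 4, YTableau (μ i)) (f : MPoly F n),
          MIsIdentity S (symAct F T f) := by
  rw [hook_iff_chi S d l]
  exact ⟨amitsur_to_chi S d l, chi_to_amitsur S d l⟩

end SSA
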